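/- Let n ≥ 2, let Ω ⊂ ℝⁿ be a bounded open set, and let Ω* = Ω*_1 ∪ Ω*_2 where Ω*_1, Ω*_2 ⊂ ℝⁿ are bounded convex open sets (possibly overlapping), with |Ω| = |Ω*|. Let u : ℝⁿ → ℝ be a globally Lipschitz convex function with Du(x) ∈ closure(Ω*) for a.e. x and (Du)_♯(Lⁿ|_Ω) = Lⁿ|_{Ω*}, i.e. |{x ∈ Ω : u differentiable at x, Du(x) ∈ E}| = |E ∩ Ω*| for every Borel set E ⊂ ℝⁿ, and let A := {x ∈ Ω : u is not differentiable at x} be its singular set. Then for every x ∈ A there exist r_x > 0 and α ∈ (0,1) such that A ∩ B_{r_x}(x) is an (n−1)-dimensional C^{1,α} graph: there exist an orthonormal basis e_1,…,e_n of ℝⁿ and a C^{1,α} function g : ℝ^{n−1} → ℝ (g differentiable with α-Hölder gradient) such that A ∩ B_{r_x}(x) = {x + Σ_{i<n} t_i e_i + g(t) e_n : t ∈ ℝ^{n−1}} ∩ B_{r_x}(x). -/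

import Mathlib

open MeasureTheory Metric Set
open scoped NNReal ENNReal RealInnerProductSpace

noncomputable section

set_option linter.unusedSectionVars false

/-- The set of (global) subgradients of `u` at `x`. -/
def subgrad {E : Type*} [NormedAddCommGroup E] [InnerProductSpace ℝ E] (u : E → ℝ) (x : E) :
    Set E :=
  {p | ∀ z, u x + ⟪p, z - x⟫ ≤ u z}

/-- The convex conjugate of the restriction of `u` to `Ω`. -/
def cvxConj {E : Type*} [NormedAddCommGroup E] [InnerProductSpace ℝ E] (Ω : Set E) (u : E → ℝ)
    (p : E) : ℝ :=
  ⨆ y : Ω, (⟪p, (y : E)⟫ - u y)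

/-- The defect in the Fenchel-Young inequality for the pair `(x, p)`. -/
def fenchelGap {E : Type*} [NormedAddCommGroup E] [InnerProductSpace ℝ E] (Ω : Set E) (u : E → ℝ)
    (x p : E) : ℝ :=
  cvxConj Ω u p + u x - ⟪p, x⟫

/-- A continuous convex potential whose gradient transports `μ` on the bounded open set `Ω` to `μ`
on the union of the bounded open convex sets `P₁` and `P₂`. -/
structure IsTransportPotential {E : Type*} [NormedAddCommGroup E] [InnerProductSpace ℝ E]
    [CompleteSpace E] [MeasurableSpace E] (μ : Measure E) (Ω P₁ P₂ : Set E) (u : E → ℝ) :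
    Prop where
  isOpen_source : IsOpen Ω
  bounded_source : Bornology.IsBounded Ω
  isOpen_left : IsOpen P₁
  bounded_left : Bornology.IsBounded P₁
  convex_left : Convex ℝ P₁
  isOpen_right : IsOpen P₂
  bounded_right : Bornology.IsBounded P₂
  convex_right : Convex ℝ P₂
  convexOn : ConvexOn ℝ univ u
  continuous : Continuous u
  ae_mem : ∀ᵐ x ∂μ, DifferentiableAt ℝ u x ∧ gradient u x ∈ closure (P₁ ∪ P₂)
  push : ∀ S : Set E, MeasurableSet S →
    μ {x ∈ Ω | DifferentiableAt ℝ u x ∧ gradient u x ∈ S} = μ (S ∩ (P₁ ∪ P₂))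

section Subgradients

variable {E : Type*} [NormedAddCommGroup E] [InnerProductSpace ℝ E]
  {Ω P₁ P₂ : Set E} {u : E → ℝ} {x y p q : E}

lemma subgrad_monotone (hp : p ∈ subgrad u x) (hq : q ∈ subgrad u y) : 0 ≤ ⟪p - q, x - y⟫ := by
  have h1 := hp y
  have h2 := hq x
  have h3 : ⟪p, y - x⟫ = - ⟪p, x - y⟫ := by rw [← inner_neg_right, neg_sub]
  rw [inner_sub_left]
  linarith

lemma mem_subgrad_of_tendsto (hu : Continuous u) {xs ps : ℕ → E}
    (hx : Filter.Tendsto xs Filter.atTop (nhds x)) (hp : Filter.Tendsto ps Filter.atTop (nhds p))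
    (h : ∀ k, ps k ∈ subgrad u (xs k)) : p ∈ subgrad u x := by
  intro z
  refine le_of_tendsto (f := fun k => u (xs k) + ⟪ps k, z - xs k⟫) (x := Filter.atTop) ?_
    (Filter.Eventually.of_forall fun k => h k z)
  exact ((hu.tendsto x).comp hx).add (hp.inner (tendsto_const_nhds.sub hx))

lemma convex_subgrad (u : E → ℝ) (x : E) : Convex ℝ (subgrad u x) := by
  intro p hp q hq a b ha hb hab z
  have h1 := mul_le_mul_of_nonneg_left (hp z) ha
  have h2 := mul_le_mul_of_nonneg_left (hq z) hb
  rw [inner_add_left, real_inner_smul_left, real_inner_smul_left]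
  have h3 : b = 1 - a := by linarith
  subst h3
  linarith

lemma isClosed_subgrad (u : E → ℝ) (x : E) : IsClosed (subgrad u x) := by
  have : subgrad u x = ⋂ z, {p | u x + ⟪p, z - x⟫ ≤ u z} := by
    ext p; simp [subgrad]
  rw [this]
  exact isClosed_iInter fun z => isClosed_le (by fun_prop) continuous_const

lemma gradient_mem_subgrad [CompleteSpace E] (hu : ConvexOn ℝ univ u)
    (hd : DifferentiableAt ℝ u x) : gradient u x ∈ subgrad u x := by
  intro z
  have hg := hd.hasGradientAt.hasFDerivAt
  have hline : HasDerivAt (fun t : ℝ => u (x + t • (z - x))) ⟪gradient u x, z - x⟫ 0 := by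
    have h1 : HasDerivAt (fun t : ℝ => x + t • (z - x)) (z - x) 0 := by
      simpa using ((hasDerivAt_id (0 : ℝ)).smul_const (z - x)).const_add x
    have h2 : HasFDerivAt u (InnerProductSpace.toDual ℝ E (gradient u x))
        (x + (0 : ℝ) • (z - x)) := by simpa using hg
    exact h2.comp_hasDerivAt (0 : ℝ) h1
  have hc : ConvexOn ℝ univ (fun t : ℝ => u (x + t • (z - x))) := by
    have := hu.comp_affineMap (AffineMap.lineMap x z)
    simpa [Function.comp_def, AffineMap.lineMap_apply, add_comm] using this
  have := hc.le_slope_of_hasDerivAt (mem_univ 0) (mem_univ 1) one_pos hline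
  simp only [slope_def_field, zero_smul, one_smul, add_zero, add_sub_cancel, sub_zero, div_one]
    at this
  linarith

lemma eq_gradient_of_mem_subgrad [CompleteSpace E] (hd : DifferentiableAt ℝ u x)
    (hp : p ∈ subgrad u x) : p = gradient u x := by
  have hg := hd.hasGradientAt.hasFDerivAt
  have h1 : HasFDerivAt (fun z => u z - ⟪p, z⟫)
      (InnerProductSpace.toDual ℝ E (gradient u x) - innerSL ℝ p) x :=
    hg.sub (innerSL ℝ p).hasFDerivAt
  have hmin : IsLocalMin (fun z => u z - ⟪p, z⟫) x := by
    refine Filter.Eventually.of_forall fun z => ?_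
    have := hp z
    rw [inner_sub_right] at this
    simp only
    linarith
  have h0 := hmin.hasFDerivAt_eq_zero h1
  refine ext_inner_right ℝ fun v => ?_
  have := congrArg (fun f => f v) h0
  rw [sub_apply, zero_apply, InnerProductSpace.toDual_apply_apply, innerSL_apply_apply] at this
  linarith

lemma bddAbove_conj [FiniteDimensional ℝ E] (hb : Bornology.IsBounded Ω) (hu : Continuous u)
    (p : E) : BddAbove (range fun y : Ω => (⟪p, (y : E)⟫ - u y)) := by
  have hcont : Continuous fun y : E => ⟪p, y⟫ - u y := by fun_prop
  have := (hb.isCompact_closure.image hcont).bddAbove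
  refine this.mono ?_
  rintro _ ⟨y, rfl⟩
  exact ⟨y, subset_closure y.2, rfl⟩

lemma le_fenchelGap [FiniteDimensional ℝ E] (hb : Bornology.IsBounded Ω) (hu : Continuous u)
    (x p : E) (hy : y ∈ Ω) : ⟪p, y - x⟫ + u x - u y ≤ fenchelGap Ω u x p := by
  have := le_ciSup (bddAbove_conj hb hu p) ⟨y, hy⟩
  unfold fenchelGap cvxConj
  rw [inner_sub_right]
  simp only at this
  linarith

lemma fenchelGap_eq [FiniteDimensional ℝ E] (hb : Bornology.IsBounded Ω) (hu : Continuous u)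
    (x : E) (hy : y ∈ Ω) (hp : p ∈ subgrad u y) :
    fenchelGap Ω u x p = ⟪p, y - x⟫ + u x - u y := by
  refine le_antisymm ?_ (le_fenchelGap hb hu x p hy)
  have : cvxConj Ω u p ≤ ⟪p, y⟫ - u y := by
    have : Nonempty Ω := ⟨⟨y, hy⟩⟩
    refine ciSup_le fun z => ?_
    have := hp z
    rw [inner_sub_right] at this
    linarith
  unfold fenchelGap
  rw [inner_sub_right]
  linarith

lemma fenchelGap_nonneg [FiniteDimensional ℝ E] (hb : Bornology.IsBounded Ω) (hu : Continuous u)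
    (hx : x ∈ Ω) (p : E) : 0 ≤ fenchelGap Ω u x p := by
  simpa using le_fenchelGap hb hu x p hx

lemma fenchelGap_eq_zero_iff [FiniteDimensional ℝ E] (ho : IsOpen Ω) (hb : Bornology.IsBounded Ω)
    (hu : Continuous u) (hconv : ConvexOn ℝ univ u) (hx : x ∈ Ω) :
    fenchelGap Ω u x p = 0 ↔ p ∈ subgrad u x := by
  constructor
  · intro h
    have hc : ConvexOn ℝ univ fun z => u z - ⟪p, z⟫ := by
      refine hconv.sub ⟨convex_univ, fun a _ b _ s t _ _ _ => ?_⟩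
      rw [inner_add_right, real_inner_smul_right, real_inner_smul_right]
      rfl
    have hmin : IsLocalMin (fun z => u z - ⟪p, z⟫) x := by
      filter_upwards [ho.mem_nhds hx] with y hy
      have := le_fenchelGap hb hu x p hy
      rw [inner_sub_right] at this
      linarith
    have := IsMinOn.of_isLocalMin_of_convex_univ hmin hc
    intro z
    have := this z
    rw [inner_sub_right]
    linarith
  · intro h
    simpa using fenchelGap_eq hb hu x hx h

lemma fenchelGap_sub (Ω : Set E) (u : E → ℝ) (x x' p : E) :
    fenchelGap Ω u x' p = fenchelGap Ω u x p + (u x' - u x - ⟪p, x' - x⟫) := by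
  unfold fenchelGap
  rw [inner_sub_right]
  ring

lemma convexOn_fenchelGap [FiniteDimensional ℝ E] (hb : Bornology.IsBounded Ω) (hu : Continuous u)
    (hx : x ∈ Ω) (x₀ : E) : ConvexOn ℝ univ (fenchelGap Ω u x₀) := by
  refine ⟨convex_univ, fun a _ b _ s t hs ht hst => ?_⟩
  have : Nonempty Ω := ⟨⟨x, hx⟩⟩
  have hc : cvxConj Ω u (s • a + t • b) ≤ s * cvxConj Ω u a + t * cvxConj Ω u b := by
    refine ciSup_le fun y => ?_
    have h1 := mul_le_mul_of_nonneg_left (le_ciSup (bddAbove_conj hb hu a) y) hs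
    have h2 := mul_le_mul_of_nonneg_left (le_ciSup (bddAbove_conj hb hu b) y) ht
    change s * (⟪a, (y : E)⟫ - u y) ≤ s * cvxConj Ω u a at h1
    change t * (⟪b, (y : E)⟫ - u y) ≤ t * cvxConj Ω u b at h2
    rw [inner_add_left, real_inner_smul_left, real_inner_smul_left]
    have h3 : t = 1 - s := by linarith
    subst h3
    linarith
  unfold fenchelGap
  rw [inner_add_left, real_inner_smul_left, real_inner_smul_left, smul_eq_mul, smul_eq_mul]
  have h3 : t = 1 - s := by linarith
  subst h3
  linarith

lemma continuous_fenchelGap [FiniteDimensional ℝ E] (hb : Bornology.IsBounded Ω)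
    (hu : Continuous u) (hx : x ∈ Ω) (x₀ : E) : Continuous (fenchelGap Ω u x₀) :=
  continuousOn_univ.1 ((convexOn_fenchelGap hb hu hx x₀).continuousOn isOpen_univ)

/-- If the zeros of a nonnegative continuous function on a compact set lie in an open set, so do
the points with sufficiently small values. -/
lemma exists_pos_forall_le_imp_mem {X : Type*} [TopologicalSpace X] {K V : Set X} {f : X → ℝ}
    (hK : IsCompact K) (hV : IsOpen V) (hf : Continuous f) (hf0 : ∀ p ∈ K, 0 ≤ f p)
    (h : ∀ p ∈ K, f p = 0 → p ∈ V) : ∃ τ > 0, ∀ p ∈ K, f p ≤ τ → p ∈ V := by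
  rcases (K \ V).eq_empty_or_nonempty with he | hne
  · exact ⟨1, one_pos, fun p hp _ => by_contra fun hn => (he ▸ ⟨hp, hn⟩ : p ∈ (∅ : Set X))⟩
  · obtain ⟨q, hq, hmin⟩ := (hK.diff hV).exists_isMinOn hne hf.continuousOn
    have hpos : 0 < f q := lt_of_le_of_ne (hf0 q hq.1) fun h0 => hq.2 (h q hq.1 h0.symm)
    refine ⟨f q / 2, by linarith, fun p hp hle => by_contra fun hn => ?_⟩
    have : f q ≤ f p := hmin ⟨hp, hn⟩
    linarith

end Subgradients

namespace IsTransportPotential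


variable {E : Type*} [NormedAddCommGroup E] [InnerProductSpace ℝ E] [FiniteDimensional ℝ E]
  [CompleteSpace E] [MeasurableSpace E] [BorelSpace E] {μ : Measure E} [μ.IsAddHaarMeasure]
  {Ω P₁ P₂ : Set E} {u : E → ℝ}

lemma symm (H : IsTransportPotential μ Ω P₁ P₂ u) : IsTransportPotential μ Ω P₂ P₁ u where
  isOpen_source := H.isOpen_source
  bounded_source := H.bounded_source
  isOpen_left := H.isOpen_right
  bounded_left := H.bounded_right
  convex_left := H.convex_right
  isOpen_right := H.isOpen_left
  bounded_right := H.bounded_left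
  convex_right := H.convex_left
  convexOn := H.convexOn
  continuous := H.continuous
  ae_mem := by simpa only [union_comm] using H.ae_mem
  push := by simpa only [union_comm] using H.push

lemma isCompact_target (H : IsTransportPotential μ Ω P₁ P₂ u) : IsCompact (closure (P₁ ∪ P₂)) :=
  (H.bounded_left.union H.bounded_right).isCompact_closure

/-- In every direction some subgradient in the closed target is extremal. -/
lemma exists_subgrad_max (H : IsTransportPotential μ Ω P₁ P₂ u) (x e : E) :
    ∃ p ∈ subgrad u x, p ∈ closure (P₁ ∪ P₂) ∧ ∀ q ∈ subgrad u x, ⟪q, e⟫ ≤ ⟪p, e⟫ := by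
  have hdense := Measure.dense_of_ae H.ae_mem
  have hex : ∀ k : ℕ, ∃ w : E, dist w e < 1 / ((k : ℝ) + 1) ∧
      DifferentiableAt ℝ u (x + (1 / ((k : ℝ) + 1)) • w) ∧
      gradient u (x + (1 / ((k : ℝ) + 1)) • w) ∈ closure (P₁ ∪ P₂) := by
    intro k
    set t : ℝ := 1 / ((k : ℝ) + 1) with ht
    have htp : 0 < t := by positivity
    obtain ⟨y, hy, hyd⟩ := hdense.exists_dist_lt (x + t • e) (mul_pos htp htp)
    have hxy : x + t • (t⁻¹ • (y - x)) = y := by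
      rw [smul_smul, mul_inv_cancel₀ htp.ne', one_smul]; abel
    refine ⟨t⁻¹ • (y - x), ?_, by rw [hxy]; exact hy.1, by rw [hxy]; exact hy.2⟩
    have h1 : t⁻¹ • (y - x) - e = t⁻¹ • (y - (x + t • e)) := by
      rw [smul_sub, smul_sub, smul_add, smul_smul, inv_mul_cancel₀ htp.ne', one_smul]; abel
    rw [dist_eq_norm, h1, norm_smul, norm_inv, Real.norm_of_nonneg htp.le, ← dist_eq_norm,
      dist_comm, inv_mul_lt_iff₀ htp]
    exact hyd
  choose w hwe hwd hwc using hex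
  have ht0 := tendsto_one_div_add_atTop_nhds_zero_nat (𝕜 := ℝ)
  have hw : Filter.Tendsto w Filter.atTop (nhds e) := by
    rw [tendsto_iff_dist_tendsto_zero]
    exact squeeze_zero (fun _ => dist_nonneg) (fun k => (hwe k).le) ht0
  obtain ⟨p, hpc, φ, hφ, hlim⟩ := H.isCompact_target.tendsto_subseq hwc
  have hw' := hw.comp hφ.tendsto_atTop
  have hx : Filter.Tendsto (fun k => x + (1 / ((φ k : ℝ) + 1)) • w (φ k)) Filter.atTop
      (nhds x) := by
    have := (tendsto_const_nhds (x := x)).add ((ht0.comp hφ.tendsto_atTop).smul hw')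
    simpa using this
  have hmem : ∀ k, gradient u (x + (1 / ((φ k : ℝ) + 1)) • w (φ k)) ∈
      subgrad u (x + (1 / ((φ k : ℝ) + 1)) • w (φ k)) := fun k =>
    gradient_mem_subgrad H.convexOn (hwd _)
  refine ⟨p, mem_subgrad_of_tendsto H.continuous hx hlim hmem, hpc, fun q hq => ?_⟩
  have hge : 0 ≤ ⟪p - q, e⟫ := by
    refine ge_of_tendsto' ((hlim.sub (tendsto_const_nhds (x := q))).inner hw') fun k => ?_
    have := subgrad_monotone (hmem k) hq
    rw [add_sub_cancel_left, real_inner_smul_right] at this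
    exact nonneg_of_mul_nonneg_right this (by positivity)
  rw [inner_sub_left] at hge
  linarith

lemma exists_subgrad (H : IsTransportPotential μ Ω P₁ P₂ u) (x : E) :
    ∃ p ∈ subgrad u x, p ∈ closure (P₁ ∪ P₂) := by
  obtain ⟨p, hp, hp', -⟩ := H.exists_subgrad_max x 0
  exact ⟨p, hp, hp'⟩

lemma differentiableAt_of_subgrad_subsingleton (H : IsTransportPotential μ Ω P₁ P₂ u) {x : E}
    (hs : (subgrad u x).Subsingleton) : DifferentiableAt ℝ u x := by
  obtain ⟨p, hp, -⟩ := H.exists_subgrad x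
  choose g hg hgc using H.exists_subgrad
  have hcont : Filter.Tendsto g (nhds x) (nhds p) := by
    refine Filter.tendsto_of_subseq_tendsto fun ys hys => ?_
    obtain ⟨q, -, φ, hφ, hlim⟩ := H.isCompact_target.tendsto_subseq fun k => hgc (ys k)
    have hq : q ∈ subgrad u x :=
      mem_subgrad_of_tendsto H.continuous (hys.comp hφ.tendsto_atTop) hlim fun k => hg _
    exact ⟨φ, hs hq hp ▸ hlim⟩
  have : HasGradientAt u p x := by
    rw [hasGradientAt_iff_isLittleO, Asymptotics.isLittleO_iff]
    intro ε hε
    filter_upwards [hcont (Metric.ball_mem_nhds p hε)] with y hy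
    have h1 := hp y
    have h2 := hg y x
    rw [Real.norm_of_nonneg (by linarith)]
    have h3 : ⟪g y, x - y⟫ = - ⟪g y, y - x⟫ := by rw [← inner_neg_right, neg_sub]
    have h4 : u y - u x - ⟪p, y - x⟫ ≤ ⟪g y - p, y - x⟫ := by
      rw [inner_sub_left]; linarith
    refine h4.trans ((real_inner_le_norm _ _).trans ?_)
    gcongr
    simpa [dist_eq_norm] using (mem_ball.1 hy).le
  exact this.differentiableAt

end IsTransportPotential

section Measure

variable {E : Type*} [NormedAddCommGroup E] [InnerProductSpace ℝ E] [FiniteDimensional ℝ E]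
  [MeasurableSpace E] [BorelSpace E] {μ : Measure E} [μ.IsAddHaarMeasure]

lemma measure_preimage_add_smul {c : ℝ} (hc : 0 < c) (a : E) (S : Set E) :
    μ ((fun y => a + c • y) ⁻¹' S) = ENNReal.ofReal ((c⁻¹) ^ Module.finrank ℝ E) * μ S := by
  have h1 : (fun y => a + c • y) ⁻¹' S = (c • ·) ⁻¹' ((a + ·) ⁻¹' S) := rfl
  rw [h1, Measure.addHaar_preimage_smul μ hc.ne', measure_preimage_add, inv_pow, abs_of_pos]
  positivity

lemma measurable_gradient [CompleteSpace E] (u : E → ℝ) : Measurable (gradient u) :=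
  (InnerProductSpace.toDual ℝ E).symm.continuous.measurable.comp (measurable_fderiv ℝ u)

end Measure

lemma Convex.combo_mem_of_isOpen {E : Type*} [NormedAddCommGroup E] [NormedSpace ℝ E] {Q : Set E}
    (hc : Convex ℝ Q) (ho : IsOpen Q) {a p : E} (ha : a ∈ closure Q) (hp : p ∈ Q) {t : ℝ}
    (ht0 : 0 < t) (ht1 : t ≤ 1) : (1 - t) • a + t • p ∈ Q := by
  have h := hc.combo_closure_interior_mem_interior ha (ho.interior_eq.symm ▸ hp)
    (sub_nonneg.2 ht1) ht0 (by ring)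
  exact interior_subset h

namespace IsTransportPotential

variable {E : Type*} [NormedAddCommGroup E] [InnerProductSpace ℝ E] [FiniteDimensional ℝ E]
  [CompleteSpace E] [MeasurableSpace E] [BorelSpace E] {μ : Measure E} [μ.IsAddHaarMeasure]
  {Ω P₁ P₂ : Set E} {u : E → ℝ} {x p₀ k₁ k e : E} {r R h w : ℝ}

lemma fenchelGap_combo_le (H : IsTransportPotential μ Ω P₁ P₂ u) (hx : x ∈ Ω) (x₀ a b : E) {t : ℝ}
    (ht0 : 0 ≤ t) (ht1 : t ≤ 1) : fenchelGap Ω u x₀ ((1 - t) • a + t • b) ≤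
      (1 - t) * fenchelGap Ω u x₀ a + t * fenchelGap Ω u x₀ b :=
  (convexOn_fenchelGap H.bounded_source H.continuous hx x₀).2 (mem_univ a) (mem_univ b)
    (sub_nonneg.2 ht1) ht0 (by ring)

lemma measurable_fenchelGap (H : IsTransportPotential μ Ω P₁ P₂ u) (hx : x ∈ Ω) (x₀ : E) :
    Measurable (fenchelGap Ω u x₀) :=
  (continuous_fenchelGap H.bounded_source H.continuous hx x₀).measurable

/-- Disjoint translates of a contracted preimage of a section are all transported into a
controlled enlargement of the section. -/
lemma mul_measure_section_le (H : IsTransportPotential μ Ω P₁ P₂ u) (hr0 : 0 < r) (hrR : r ≤ R)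
    (hr : closedBall x r ⊆ Ω) (hR : Ω ⊆ ball x R) (hp₀ : p₀ ∈ closure P₁) (hk₁ : k₁ ∈ closure P₁)
    (gp₀ : fenchelGap Ω u x p₀ ≤ h) (gk₁ : fenchelGap Ω u x k₁ ≤ h) (hh : 0 < h)
    (hw : ⟪e, p₀ - k₁⟫ = w) (hw0 : 0 < w) (j₀ N : ℕ)
    (hs : 4 * h * ((j₀ + N : ℕ) : ℝ) / w * ‖e‖ ≤ r / 2) :
    (N : ℝ≥0∞) * (ENNReal.ofReal ((r / (2 * R)) ^ Module.finrank ℝ E) *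
      (ENNReal.ofReal ((3⁻¹ : ℝ) ^ Module.finrank ℝ E) * μ {p ∈ P₁ | fenchelGap Ω u x p ≤ h})) ≤
    μ ({p | ∃ j ∈ Finset.Ioc j₀ (j₀ + N),
      fenchelGap Ω u x p ≤ 4 * h + 8 * j * h * ⟪e, p - p₀⟫ / w} ∩ (P₁ ∪ P₂)) := by
  have hR0 : 0 < R := hr0.trans_le hrR
  have hxΩ : x ∈ Ω := hr (mem_closedBall_self hr0.le)
  have hgm := H.measurable_fenchelGap hxΩ x
  set θ : ℝ := r / (2 * R) with hθ
  have hθ0 : 0 < θ := by positivity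
  have hθR : θ * R = r / 2 := by rw [hθ]; field_simp
  have hθ1 : θ ≤ 1 / 2 := by rw [hθ, div_le_iff₀ (by positivity)]; linarith
  set W : Set E := {p ∈ P₁ | fenchelGap Ω u x p ≤ h} with hW
  have hWm : MeasurableSet W := H.isOpen_left.measurableSet.inter (hgm measurableSet_Iic)
  set D : Set E := (fun p => -(p₀ + k₁) + (3 : ℝ) • p) ⁻¹' W with hD
  have hDm : MeasurableSet D := by
    refine (Continuous.measurable ?_) hWm
    fun_prop
  have hDP : D ⊆ P₁ := by
    intro p hp
    have h1 : ((1 : ℝ) - 1 / 2) • p₀ + (1 / 2 : ℝ) • k₁ ∈ closure P₁ :=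
      H.convex_left.closure hp₀ hk₁ (by norm_num) (by norm_num) (by norm_num)
    have h2 := H.convex_left.combo_mem_of_isOpen H.isOpen_left h1 hp.1
      (t := 1 / 3) (by norm_num) (by norm_num)
    have h3 : p = (1 - 1 / 3 : ℝ) • (((1 : ℝ) - 1 / 2) • p₀ + (1 / 2 : ℝ) • k₁) +
      (1 / 3 : ℝ) • (-(p₀ + k₁) + (3 : ℝ) • p) := by module
    rw [h3]
    exact h2
  set Y : Set E := {y ∈ Ω | DifferentiableAt ℝ u y ∧ gradient u y ∈ D} with hY
  have hYm : MeasurableSet Y := H.isOpen_source.measurableSet.inter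
    ((measurableSet_of_differentiableAt ℝ u).inter (measurable_gradient u hDm))
  have hYD : μ Y = ENNReal.ofReal ((3⁻¹ : ℝ) ^ Module.finrank ℝ E) * μ W := by
    rw [hY, H.push D hDm, inter_eq_left.2 (hDP.trans subset_union_left), hD,
      measure_preimage_add_smul (by norm_num)]
  have hlow : ∀ η ∈ Y, ∀ q, ⟪q - gradient u η, η - x⟫ ≤ fenchelGap Ω u x q := by
    intro η hη q
    have h1 := le_fenchelGap H.bounded_source H.continuous x q hη.1
    have h2 := gradient_mem_subgrad H.convexOn hη.2.1 x
    have h3 : ⟪gradient u η, x - η⟫ = - ⟪gradient u η, η - x⟫ := by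
      rw [← inner_neg_right, neg_sub]
    rw [inner_sub_left]
    linarith
  have hslab : ∀ η ∈ Y, ∀ a b : E, fenchelGap Ω u x b ≤ h → a + b = p₀ + k₁ →
      ⟪gradient u η - a, η - x⟫ ≤ 2 * h := by
    intro η hη a b hb hab
    have h1 := hlow η hη (((1 : ℝ) - 1 / 2) • b +
      (1 / 2 : ℝ) • (-(p₀ + k₁) + (3 : ℝ) • gradient u η))
    have h2 := H.fenchelGap_combo_le hxΩ x b (-(p₀ + k₁) + (3 : ℝ) • gradient u η)
      (t := 1 / 2) (by norm_num) (by norm_num)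
    have h3 : fenchelGap Ω u x (-(p₀ + k₁) + (3 : ℝ) • gradient u η) ≤ h := hη.2.2.2
    have h4 : (((1 : ℝ) - 1 / 2) • b + (1 / 2 : ℝ) • (-(p₀ + k₁) + (3 : ℝ) • gradient u η)) -
        gradient u η = (1 / 2 : ℝ) • (gradient u η - a) := by
      rw [← hab]; module
    rw [h4, real_inner_smul_left] at h1
    linarith
  have hslab₀ : ∀ η ∈ Y, ⟪gradient u η - p₀, η - x⟫ ≤ 2 * h := fun η hη =>
    hslab η hη p₀ k₁ gk₁ rfl
  have hslab₁ : ∀ η ∈ Y, ⟪gradient u η - k₁, η - x⟫ ≤ 2 * h := fun η hη =>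
    hslab η hη k₁ p₀ gp₀ (add_comm _ _)
  have habs : ∀ η ∈ Y, |⟪p₀ - k₁, η - x⟫| ≤ 3 * h := by
    intro η hη
    have a1 := hslab₀ η hη
    have a2 := hslab₁ η hη
    have a3 := hlow η hη p₀
    have a4 := hlow η hη k₁
    rw [inner_sub_left] at a1 a2 a3 a4 ⊢
    exact abs_le.2 ⟨by linarith, by linarith⟩
  set s : ℕ → ℝ := fun j => 4 * h * j / w with hsdef
  have hinj : ∀ (j : ℕ) (y : E), (x - θ⁻¹ • (x + s j • e)) + θ⁻¹ • y ∈ Y →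
      ∃ η ∈ Y, y = x + θ • (η - x) + s j • e := by
    intro j y hy
    refine ⟨_, hy, ?_⟩
    rw [smul_sub, smul_add, smul_sub, smul_smul, smul_smul, mul_inv_cancel₀ hθ0.ne']
    module
  set T : ℕ → Set E := fun j => (fun y => (x - θ⁻¹ • (x + s j • e)) + θ⁻¹ • y) ⁻¹' Y with hT
  have hTm : ∀ j, MeasurableSet (T j) := by
    intro j
    refine (Continuous.measurable ?_) hYm
    fun_prop
  have hTmeas : ∀ j, μ (T j) = ENNReal.ofReal (θ ^ Module.finrank ℝ E) * μ Y := by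
    intro j
    rw [hT]
    simp only
    rw [measure_preimage_add_smul (inv_pos.2 hθ0), inv_inv]
  have hTabs : ∀ j, ∀ y ∈ T j, |⟪p₀ - k₁, y - x⟫ - 4 * h * j| ≤ 3 / 2 * h := by
    intro j y hy
    obtain ⟨η, hη, rfl⟩ := hinj j y hy
    have h1 : x + θ • (η - x) + s j • e - x = θ • (η - x) + s j • e := by abel
    rw [h1, inner_add_right, real_inner_smul_right, real_inner_smul_right, real_inner_comm, hsdef]
    have h2 : ⟪p₀ - k₁, e⟫ = w := by rw [real_inner_comm, hw]
    rw [h2]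
    simp only
    rw [div_mul_cancel₀ _ hw0.ne', add_sub_cancel_right, abs_mul, abs_of_pos hθ0, real_inner_comm]
    have := habs η hη
    nlinarith [abs_nonneg ⟪p₀ - k₁, η - x⟫]
  have hdisj : Set.PairwiseDisjoint (↑(Finset.Ioc j₀ (j₀ + N))) T := by
    intro i _ j _ hij
    refine Set.disjoint_left.2 fun y hy hy' => hij ?_
    have h1 := abs_le.1 (hTabs i y hy)
    have h2 := abs_le.1 (hTabs j y hy')
    have h3 : (i : ℝ) < j + 1 := by by_contra! hc; nlinarith
    have h4 : (j : ℝ) < i + 1 := by by_contra! hc; nlinarith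
    norm_cast at h3 h4
    omega
  have hsum : μ (⋃ j ∈ Finset.Ioc j₀ (j₀ + N), T j) =
      (N : ℝ≥0∞) * (ENNReal.ofReal (θ ^ Module.finrank ℝ E) * μ Y) := by
    rw [measure_biUnion_finset hdisj fun j _ => hTm j]
    simp [hTmeas]
  set Z : Set E := {p | ∃ j ∈ Finset.Ioc j₀ (j₀ + N),
      fenchelGap Ω u x p ≤ 4 * h + 8 * j * h * ⟪e, p - p₀⟫ / w} with hZ
  have hZm : MeasurableSet Z := by
    have : Z = ⋃ j ∈ Finset.Ioc j₀ (j₀ + N),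
        {p | fenchelGap Ω u x p ≤ 4 * h + 8 * j * h * ⟪e, p - p₀⟫ / w} := by
      ext p; simp [hZ]
    rw [this]
    refine Finset.measurableSet_biUnion _ fun j _ => measurableSet_le hgm ?_
    refine Continuous.measurable ?_
    fun_prop
  rw [← hYD, ← hsum, ← H.push Z hZm]
  refine measure_mono_ae ?_
  filter_upwards [H.ae_mem] with y hyd hy
  obtain ⟨j, hj, hyj⟩ := Set.mem_iUnion₂.1 hy
  obtain ⟨η, hη, rfl⟩ := hinj j y hyj
  set y := x + θ • (η - x) + s j • e with hydef
  have hyx : y - x = θ • (η - x) + s j • e := by rw [hydef]; abel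
  have hjL : (j : ℝ) ≤ ((j₀ + N : ℕ) : ℝ) := by exact_mod_cast (Finset.mem_Ioc.1 hj).2
  have hsj0 : 0 ≤ s j := by rw [hsdef]; positivity
  have hyΩ : y ∈ Ω := by
    refine hr (mem_closedBall_iff_norm.2 ?_)
    rw [hyx]
    have h1 : ‖η - x‖ < R := by simpa [dist_eq_norm] using hR hη.1
    have h2 : s j ≤ 4 * h * ((j₀ + N : ℕ) : ℝ) / w := by rw [hsdef]; simp only; gcongr
    calc ‖θ • (η - x) + s j • e‖ ≤ ‖θ • (η - x)‖ + ‖s j • e‖ := norm_add_le _ _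
      _ = θ * ‖η - x‖ + s j * ‖e‖ := by
        rw [norm_smul, norm_smul, Real.norm_of_nonneg hθ0.le, Real.norm_of_nonneg hsj0]
      _ ≤ θ * R + 4 * h * ((j₀ + N : ℕ) : ℝ) / w * ‖e‖ := by gcongr
      _ ≤ r := by linarith
  refine ⟨hyΩ, hyd.1, j, hj, ?_⟩
  set p := gradient u y with hpdef
  have hp := gradient_mem_subgrad H.convexOn hyd.1
  have e1 := fenchelGap_eq H.bounded_source H.continuous x hyΩ hp
  have e2 := le_fenchelGap H.bounded_source H.continuous x p₀ hyΩ
  have e3 := hlow η hη p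
  have e4 := hslab₀ η hη
  have e5 : ⟪p, y - x⟫ - ⟪p₀, y - x⟫ = θ * ⟪p - p₀, η - x⟫ + s j * ⟪e, p - p₀⟫ := by
    rw [← inner_sub_left, hyx, inner_add_right, real_inner_smul_right, real_inner_smul_right,
      real_inner_comm e]
  have e6 : ⟪p - p₀, η - x⟫ = ⟪p - gradient u η, η - x⟫ + ⟪gradient u η - p₀, η - x⟫ := by
    rw [← inner_add_left, sub_add_sub_cancel]
  have e7 := fenchelGap_nonneg H.bounded_source H.continuous hxΩ p
  have e8 : 8 * j * h * ⟪e, p - p₀⟫ / w = 2 * (s j * ⟪e, p - p₀⟫) := by rw [hsdef]; ring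
  rw [e8]
  have e9 : θ * ⟪p - p₀, η - x⟫ ≤ 1 / 2 * (fenchelGap Ω u x p + 2 * h) := by
    calc θ * ⟪p - p₀, η - x⟫ ≤ θ * (fenchelGap Ω u x p + 2 * h) := by gcongr; linarith
      _ ≤ _ := by gcongr
  change fenchelGap Ω u x p ≤ _
  linarith

lemma measure_section_pos (H : IsTransportPotential μ Ω P₁ P₂ u) (hx : x ∈ Ω)
    (hk : k ∈ closure P₁) (gk : fenchelGap Ω u x k = 0) (hh : 0 < h) :
    0 < μ {p ∈ P₁ | fenchelGap Ω u x p ≤ h} := by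
  have hc := continuous_fenchelGap H.bounded_source H.continuous hx x
  have ho : IsOpen (P₁ ∩ fenchelGap Ω u x ⁻¹' Iio h) :=
    H.isOpen_left.inter (isOpen_Iio.preimage hc)
  obtain ⟨q, hq, hq'⟩ := mem_closure_iff.1 hk _ (isOpen_Iio.preimage hc)
    (show fenchelGap Ω u x k < h by rw [gk]; exact hh)
  refine (ho.measure_pos μ ⟨q, hq', hq⟩).trans_le (measure_mono ?_)
  exact fun p hp => ⟨hp.1, le_of_lt hp.2⟩

lemma measure_section_lt_top (H : IsTransportPotential μ Ω P₁ P₂ u) :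
    μ {p ∈ P₁ | fenchelGap Ω u x p ≤ h} < ∞ :=
  (H.bounded_left.subset (sep_subset _ _)).measure_lt_top

lemma measure_section_nine_le (H : IsTransportPotential μ Ω P₁ P₂ u) (hx : x ∈ Ω)
    (hk : k ∈ closure P₁) (gk : fenchelGap Ω u x k = 0) :
    μ {p ∈ P₁ | fenchelGap Ω u x p ≤ 9 * h} ≤
      ENNReal.ofReal (9 ^ Module.finrank ℝ E) * μ {p ∈ P₁ | fenchelGap Ω u x p ≤ h} := by
  have := measure_preimage_add_smul (μ := μ) (c := 1 / 9) (by norm_num)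
    ((1 - 1 / 9 : ℝ) • k) {p ∈ P₁ | fenchelGap Ω u x p ≤ h}
  rw [show ((1 / 9 : ℝ))⁻¹ = 9 by norm_num] at this
  rw [← this]
  refine measure_mono fun p hp => ?_
  have h1 := H.convex_left.combo_mem_of_isOpen H.isOpen_left hk hp.1
    (t := 1 / 9) (by norm_num) (by norm_num)
  have h2 := H.fenchelGap_combo_le hx x k p (t := 1 / 9) (by norm_num) (by norm_num)
  rw [gk] at h2
  refine ⟨h1, h2.trans ?_⟩
  have := hp.2
  linarith

/-- Points of the enlargement lying in a convex piece in which the section does not grow in the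
direction `e` belong to a slightly larger section. -/
lemma fenchelGap_le_nine (H : IsTransportPotential μ Ω P₁ P₂ u) (hx : x ∈ Ω)
    (hp₀ : p₀ ∈ closure P₁) (gp₀ : fenchelGap Ω u x p₀ ≤ h) (hh : 0 < h) (hw0 : 0 < w) {L j : ℕ}
    (hL : 0 < L) (hj : j ≤ L)
    (hno : ∀ q ∈ P₁, fenchelGap Ω u x q ≤ 9 * h → ⟪e, q - p₀⟫ ≤ 1 / (2 * L) * w) {p : E}
    (hp : p ∈ P₁) (hgp : fenchelGap Ω u x p ≤ 4 * h + 8 * j * h * ⟪e, p - p₀⟫ / w) :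
    fenchelGap Ω u x p ≤ 9 * h := by
  by_contra! hcon
  set G := fenchelGap Ω u x p with hG
  have hG0 : 0 < G := by linarith
  have ht1 : 8 * h / G ≤ 1 := by rw [div_le_one hG0]; linarith
  have ht0 : 0 < 8 * h / G := by positivity
  have hq := H.convex_left.combo_mem_of_isOpen H.isOpen_left hp₀ hp ht0 ht1
  have hqg := H.fenchelGap_combo_le hx x p₀ p ht0.le ht1
  rw [← hG, div_mul_cancel₀ _ hG0.ne'] at hqg
  have h1 : (1 - 8 * h / G) * fenchelGap Ω u x p₀ ≤ 1 * h := by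
    have := fenchelGap_nonneg H.bounded_source H.continuous hx p₀
    have : 0 ≤ 1 - 8 * h / G := sub_nonneg.2 ht1
    gcongr
    linarith
  have h2 := hno _ hq (by linarith)
  have h3 : (1 - 8 * h / G) • p₀ + (8 * h / G) • p - p₀ = (8 * h / G) • (p - p₀) := by module
  rw [h3, real_inner_smul_right] at h2
  have hLr : (0 : ℝ) < L := by exact_mod_cast hL
  have hjr : (j : ℝ) ≤ L := by exact_mod_cast hj
  have h4 : 8 * j * h * ⟪e, p - p₀⟫ / w = (8 * h / G * ⟪e, p - p₀⟫) * (j * G / w) := by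
    field_simp
  have h5 : (8 * h / G * ⟪e, p - p₀⟫) * (j * G / w) ≤ (1 / (2 * L) * w) * (L * G / w) := by
    calc _ ≤ (1 / (2 * L) * w) * (j * G / w) := by gcongr
      _ ≤ _ := by gcongr
  have h6 : (1 / (2 * L) * w) * (L * G / w) = G / 2 := by field_simp
  linarith

lemma mul_measure_section_le_add (H : IsTransportPotential μ Ω P₁ P₂ u) (hr0 : 0 < r)
    (hrR : r ≤ R) (hr : closedBall x r ⊆ Ω) (hR : Ω ⊆ ball x R) (hp₀ : p₀ ∈ closure P₁)
    (hk₁ : k₁ ∈ closure P₁) (gp₀ : fenchelGap Ω u x p₀ ≤ h) (gk₁ : fenchelGap Ω u x k₁ ≤ h)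
    (hh : 0 < h) (hw : ⟪e, p₀ - k₁⟫ = w) (hw0 : 0 < w) (j₀ N : ℕ) (hN0 : 0 < N)
    (hs : 4 * h * ((j₀ + N : ℕ) : ℝ) / w * ‖e‖ ≤ r / 2)
    (hk : k ∈ closure P₁) (gk : fenchelGap Ω u x k = 0)
    (hno : ∀ q ∈ P₁, fenchelGap Ω u x q ≤ 9 * h →
      ⟪e, q - p₀⟫ ≤ 1 / (2 * ((j₀ + N : ℕ) : ℝ)) * w) {c : ℝ}
    (hc : c * 9 ^ Module.finrank ℝ E <
      N * ((r / (2 * R)) ^ Module.finrank ℝ E * 3⁻¹ ^ Module.finrank ℝ E))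
    (hZ : μ ({p | ∃ j ∈ Finset.Ioc j₀ (j₀ + N),
      fenchelGap Ω u x p ≤ 4 * h + 8 * j * h * ⟪e, p - p₀⟫ / w} ∩ P₂) ≤
      ENNReal.ofReal ((c - 1) * 9 ^ Module.finrank ℝ E) * μ {p ∈ P₁ | fenchelGap Ω u x p ≤ h})
    (hc1 : 1 ≤ c) : False := by
  have hxΩ : x ∈ Ω := hr (mem_closedBall_self hr0.le)
  have h1 := H.mul_measure_section_le hr0 hrR hr hR hp₀ hk₁ gp₀ gk₁ hh hw hw0 j₀ N hs
  rw [inter_union_distrib_left] at h1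
  have h2 : μ ({p | ∃ j ∈ Finset.Ioc j₀ (j₀ + N),
      fenchelGap Ω u x p ≤ 4 * h + 8 * j * h * ⟪e, p - p₀⟫ / w} ∩ P₁) ≤
      ENNReal.ofReal (9 ^ Module.finrank ℝ E) * μ {p ∈ P₁ | fenchelGap Ω u x p ≤ h} := by
    refine (measure_mono ?_).trans (H.measure_section_nine_le hxΩ hk gk)
    rintro p ⟨⟨j, hj, hle⟩, hp⟩
    exact ⟨hp, H.fenchelGap_le_nine hxΩ hp₀ gp₀ hh hw0 (by omega) (Finset.mem_Ioc.1 hj).2 hno hp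
      hle⟩
  have h3 := h1.trans ((measure_union_le _ _).trans (add_le_add h2 hZ))
  have hpos := H.measure_section_pos hxΩ hk gk hh
  have hlt := H.measure_section_lt_top (x := x) (h := h)
  set W := μ {p ∈ P₁ | fenchelGap Ω u x p ≤ h} with hW
  have hR0 : 0 < R := hr0.trans_le hrR
  rw [← add_mul, ← ENNReal.ofReal_add (by positivity)
    (mul_nonneg (by linarith) (by positivity)), ← mul_assoc (ENNReal.ofReal _),
    ← ENNReal.ofReal_mul (by positivity), ← mul_assoc, ← ENNReal.ofReal_natCast,
    ← ENNReal.ofReal_mul (by positivity)] at h3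
  have h4 := (ENNReal.mul_le_mul_iff_left hpos.ne' hlt.ne).1 h3
  rw [ENNReal.ofReal_le_ofReal_iff
    (add_nonneg (by positivity) (mul_nonneg (by linarith) (by positivity)))] at h4
  linarith

/-- If, at low levels, the second convex piece stays strictly below `p₀` in the direction `e`, then
the sections in the first piece grow in that direction. -/
lemma exists_growth_left (H : IsTransportPotential μ Ω P₁ P₂ u) (hr0 : 0 < r)
    (hrR : r ≤ R) (hr : closedBall x r ⊆ Ω) (hR : Ω ⊆ ball x R) (hp₀ : p₀ ∈ closure P₁)
    (hk₁ : k₁ ∈ closure P₁) (gp₀ : fenchelGap Ω u x p₀ ≤ h) (gk₁ : fenchelGap Ω u x k₁ ≤ h)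
    (hh : 0 < h) (hw : ⟪e, p₀ - k₁⟫ = w) (hw0 : 0 < w) (j₀ N : ℕ) (hN0 : 0 < N)
    (hs : 4 * h * ((j₀ + N : ℕ) : ℝ) / w * ‖e‖ ≤ r / 2)
    (hk : k ∈ closure P₁) (gk : fenchelGap Ω u x k = 0)
    (hc : 9 ^ Module.finrank ℝ E <
      N * ((r / (2 * R)) ^ Module.finrank ℝ E * 3⁻¹ ^ Module.finrank ℝ E))
    {σ τ M : ℝ} (hσ : 1 ≤ 2 * σ * j₀) (hσ0 : 0 < σ)
    (hex : ∀ p ∈ P₂, fenchelGap Ω u x p ≤ τ → ⟪e, p - p₀⟫ ≤ -(σ * w))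
    (hM : ∀ p ∈ P₂, ‖p - p₀‖ ≤ M)
    (hτ : 4 * h + 8 * ((j₀ + N : ℕ) : ℝ) * h * (‖e‖ * M) / w ≤ τ) :
    ∃ p ∈ P₁, fenchelGap Ω u x p ≤ 9 * h ∧
      1 / (2 * ((j₀ + N : ℕ) : ℝ)) * w < ⟪e, p - p₀⟫ := by
  by_contra! hno
  have hxΩ : x ∈ Ω := hr (mem_closedBall_self hr0.le)
  refine H.mul_measure_section_le_add hr0 hrR hr hR hp₀ hk₁ gp₀ gk₁ hh hw hw0 j₀ N hN0 hs hk gk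
    hno (c := 1) (by linarith) ?_ le_rfl
  rw [Set.eq_empty_of_forall_notMem (s := _ ∩ P₂) ?_]
  · simp
  rintro p ⟨⟨j, hj, hle⟩, hp⟩
  have hjL : (j : ℝ) ≤ ((j₀ + N : ℕ) : ℝ) := by exact_mod_cast (Finset.mem_Ioc.1 hj).2
  have hj0 : (j₀ : ℝ) < j := by exact_mod_cast (Finset.mem_Ioc.1 hj).1
  have hM0 : 0 ≤ M := (norm_nonneg _).trans (hM p hp)
  have h1 : 8 * j * h * ⟪e, p - p₀⟫ / w ≤ 8 * ((j₀ + N : ℕ) : ℝ) * h * (‖e‖ * M) / w := by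
    have h2 : ⟪e, p - p₀⟫ ≤ ‖e‖ * M :=
      (real_inner_le_norm _ _).trans (by have := hM p hp; gcongr)
    calc _ ≤ 8 * j * h * (‖e‖ * M) / w := by gcongr
      _ ≤ _ := by gcongr
  have h3 := hex p hp (hle.trans (by linarith))
  have h4 : 8 * j * h * ⟪e, p - p₀⟫ / w ≤ 8 * j * h * (-(σ * w)) / w := by gcongr
  have h5 : 8 * j * h * (-(σ * w)) / w = -(4 * h * (2 * σ * j)) := by field_simp; ring
  have h6 := fenchelGap_nonneg H.bounded_source H.continuous hxΩ p
  have h7 : 1 < 2 * σ * j := hσ.trans_lt (by gcongr)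
  nlinarith

/-- If both convex pieces contain the base point of the sections, then the sections grow in the
direction `e` in one of the two pieces. -/
lemma exists_growth_union (H : IsTransportPotential μ Ω P₁ P₂ u) (hr0 : 0 < r)
    (hrR : r ≤ R) (hr : closedBall x r ⊆ Ω) (hR : Ω ⊆ ball x R) (hp₀ : p₀ ∈ closure P₁)
    (hp₀' : p₀ ∈ closure P₂)
    (hk₁ : k₁ ∈ closure P₁) (gp₀ : fenchelGap Ω u x p₀ ≤ h) (gk₁ : fenchelGap Ω u x k₁ ≤ h)
    (hh : 0 < h) (hw : ⟪e, p₀ - k₁⟫ = w) (hw0 : 0 < w) (N : ℕ) (hN0 : 0 < N)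
    (hs : 4 * h * (N : ℝ) / w * ‖e‖ ≤ r / 2)
    (hk : k ∈ closure P₁) (hk' : k ∈ closure P₂) (gk : fenchelGap Ω u x k = 0)
    (hc : 2 * 9 ^ Module.finrank ℝ E <
      N * ((r / (2 * R)) ^ Module.finrank ℝ E * 3⁻¹ ^ Module.finrank ℝ E))
    (hle : μ {p ∈ P₂ | fenchelGap Ω u x p ≤ h} ≤ μ {p ∈ P₁ | fenchelGap Ω u x p ≤ h}) :
    ∃ p ∈ P₁ ∪ P₂, fenchelGap Ω u x p ≤ 9 * h ∧ 1 / (2 * (N : ℝ)) * w < ⟪e, p - p₀⟫ := by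
  by_contra! hno
  have hxΩ : x ∈ Ω := hr (mem_closedBall_self hr0.le)
  refine H.mul_measure_section_le_add hr0 hrR hr hR hp₀ hk₁ gp₀ gk₁ hh hw hw0 0 N hN0
    (by simpa using hs) hk gk (fun q hq hq' => by simpa using hno q (Or.inl hq) hq')
    (c := 2) hc ?_ one_le_two
  calc _ ≤ μ {p ∈ P₂ | fenchelGap Ω u x p ≤ 9 * h} := measure_mono ?_
    _ ≤ ENNReal.ofReal (9 ^ Module.finrank ℝ E) * μ {p ∈ P₂ | fenchelGap Ω u x p ≤ h} :=
      H.symm.measure_section_nine_le hxΩ hk' gk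
    _ ≤ ENNReal.ofReal (9 ^ Module.finrank ℝ E) * μ {p ∈ P₁ | fenchelGap Ω u x p ≤ h} := by
      gcongr
    _ = _ := by norm_num
  rintro p ⟨⟨j, hj, hj'⟩, hp⟩
  refine ⟨hp, H.symm.fenchelGap_le_nine hxΩ hp₀' gp₀ hh hw0 (e := e) hN0
    (by simpa using (Finset.mem_Ioc.1 hj).2) (fun q hq hq' => hno q (Or.inr hq) hq') hp hj'⟩

end IsTransportPotential

lemma exists_pos_mul_le (a₁ a₂ a₃ : ℝ) {b₁ b₂ b₃ : ℝ} (h₁ : 0 < b₁) (h₂ : 0 < b₂) (h₃ : 0 < b₃) :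
    ∃ h > 0, h * a₁ ≤ b₁ ∧ h * a₂ ≤ b₂ ∧ h * a₃ ≤ b₃ := by
  have key : ∀ a b : ℝ, 0 < b → ∀ᶠ h in nhdsWithin (0 : ℝ) (Ioi 0), h * a ≤ b := by
    intro a b hb
    have : Filter.Tendsto (fun h : ℝ => h * a) (nhdsWithin 0 (Ioi 0)) (nhds (0 * a)) :=
      (continuous_id.mul continuous_const).tendsto' _ _ rfl |>.mono_left nhdsWithin_le_nhds
    rw [zero_mul] at this
    exact (this.eventually_lt_const hb).mono fun _ => le_of_lt
  obtain ⟨h, hh, h1, h2, h3⟩ := (eventually_mem_nhdsWithin.and ((key a₁ b₁ h₁).and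
    ((key a₂ b₂ h₂).and (key a₃ b₃ h₃)))).exists
  exact ⟨h, hh, h1, h2, h3⟩

lemma exists_nat_mul_gt (A : ℝ) {c : ℝ} (hc : 0 < c) : ∃ N : ℕ, 0 < N ∧ A < N * c := by
  obtain ⟨N, hN⟩ := exists_nat_gt (max (A / c) 0)
  refine ⟨N, ?_, ?_⟩
  · exact_mod_cast (le_max_right _ _).trans_lt hN
  · exact (div_lt_iff₀ hc).1 ((le_max_left _ _).trans_lt hN)

namespace IsTransportPotential

variable {E : Type*} [NormedAddCommGroup E] [InnerProductSpace ℝ E] [FiniteDimensional ℝ E]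
  [CompleteSpace E] [MeasurableSpace E] [BorelSpace E] {μ : Measure E} [μ.IsAddHaarMeasure]
  {Ω P₁ P₂ : Set E} {u : E → ℝ} {x : E}

lemma exists_radii (H : IsTransportPotential μ Ω P₁ P₂ u) (hx : x ∈ Ω) :
    ∃ r R : ℝ, 0 < r ∧ r ≤ R ∧ ∀ y ∈ closedBall x r, closedBall y r ⊆ Ω ∧ Ω ⊆ ball y R := by
  obtain ⟨ε, hε, hεΩ⟩ := Metric.isOpen_iff.1 H.isOpen_source x hx
  obtain ⟨R, hR, hRΩ⟩ := H.bounded_source.subset_ball_lt 0 x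
  refine ⟨ε / 3, R + ε / 3, by positivity, by linarith, fun y hy => ⟨?_, ?_⟩⟩
  · refine (closedBall_subset_ball' (ε₂ := ε) ?_).trans hεΩ
    have := mem_closedBall.1 hy
    linarith
  · refine hRΩ.trans (ball_subset_ball' ?_)
    have := mem_closedBall'.1 hy
    linarith

lemma isCompact_subgrad_inter (H : IsTransportPotential μ Ω P₁ P₂ u) (x : E) :
    IsCompact (subgrad u x ∩ closure P₁) :=
  H.bounded_left.isCompact_closure.inter_left (isClosed_subgrad u x)

lemma fenchelGap_eq_zero (H : IsTransportPotential μ Ω P₁ P₂ u) (hx : x ∈ Ω) {p : E} :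
    fenchelGap Ω u x p = 0 ↔ p ∈ subgrad u x :=
  fenchelGap_eq_zero_iff H.isOpen_source H.bounded_source H.continuous H.convexOn hx

/-- Near-zero values of the gap on the closed convex piece force points to be near the
subgradients. -/
lemma exists_level (H : IsTransportPotential μ Ω P₁ P₂ u) (hx : x ∈ Ω) {V : Set E} (hV : IsOpen V)
    (hsub : subgrad u x ∩ closure P₁ ⊆ V) :
    ∃ τ > 0, ∀ p ∈ closure P₁, fenchelGap Ω u x p ≤ τ → p ∈ V :=
  exists_pos_forall_le_imp_mem H.bounded_left.isCompact_closure hV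
    (continuous_fenchelGap H.bounded_source H.continuous hx x)
    (fun p _ => fenchelGap_nonneg H.bounded_source H.continuous hx p)
    fun _ hp h0 => hsub ⟨(H.fenchelGap_eq_zero hx).1 h0, hp⟩

lemma exists_separating (H : IsTransportPotential μ Ω P₁ P₂ u) {a v : E}
    (ha' : a ∉ closure P₂) (hv : v ≠ 0) :
    ∃ e : E, ∃ s > 0, ⟪e, v⟫ ≠ 0 ∧ ∀ b ∈ subgrad u x ∩ closure P₂, ⟪e, b - a⟫ ≤ -s := by
  have hconv : Convex ℝ (subgrad u x ∩ closure P₂) :=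
    (convex_subgrad u x).inter H.convex_right.closure
  obtain ⟨f, t, hfa, hfb⟩ := geometric_hahn_banach_point_closed hconv
    (H.symm.isCompact_subgrad_inter x).isClosed (fun h => ha' h.2)
  obtain ⟨M, hM⟩ := (H.bounded_right.closure).exists_norm_le
  set e₁ := (InnerProductSpace.toDual ℝ E).symm f with he₁
  have hf : ∀ z, f z = ⟪e₁, z⟫ := fun z => by rw [he₁, InnerProductSpace.toDual_symm_apply]
  by_cases h0 : ⟪e₁, v⟫ = 0
  · obtain ⟨ε, hε, hε1, -, -⟩ := exists_pos_mul_le (‖v‖ * (M + ‖a‖)) 0 0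
      (b₁ := (t - f a) / 2) (by linarith) one_pos one_pos
    refine ⟨-e₁ + ε • v, (t - f a) / 2, by linarith, ?_, fun b hb => ?_⟩
    · rw [inner_add_left, inner_neg_left, h0, real_inner_smul_left, real_inner_self_eq_norm_sq]
      have := norm_pos_iff.2 hv
      simp only [neg_zero, zero_add]
      positivity
    · have h1 := hfb b hb
      rw [hf] at h1 hfa hε1 ⊢
      rw [inner_add_left, inner_neg_left, real_inner_smul_left, inner_sub_right e₁]
      have h2 : ⟪v, b - a⟫ ≤ ‖v‖ * (M + ‖a‖) := by
        refine (real_inner_le_norm _ _).trans ?_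
        gcongr
        exact (norm_sub_le _ _).trans (by gcongr; exact hM b hb.2)
      have h3 := mul_le_mul_of_nonneg_left h2 hε.le
      linarith
  · refine ⟨-e₁, t - f a, by linarith, by rwa [inner_neg_left, neg_ne_zero], fun b hb => ?_⟩
    have h1 := hfb b hb
    rw [hf] at h1 hfa ⊢
    rw [inner_neg_left, inner_sub_right]
    linarith

/-- If some subgradient in the first closed piece avoids the second one, then there is only one
subgradient in the first closed piece. -/
lemma subsingleton_of_notMem (H : IsTransportPotential μ Ω P₁ P₂ u) (hx : x ∈ Ω) {a : E}
    (ha : a ∈ subgrad u x) (ha₁ : a ∈ closure P₁) (ha₂ : a ∉ closure P₂) :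
    (subgrad u x ∩ closure P₁).Subsingleton := by
  intro c hc c' hc'
  by_contra hne
  obtain ⟨e, s, hs0, hev, hsep⟩ := H.exists_separating (x := x) ha₂ (sub_ne_zero.2 hne)
  have hcpt := H.isCompact_subgrad_inter x
  obtain ⟨p₀, hp₀, hmax⟩ := hcpt.exists_isMaxOn ⟨a, ha, ha₁⟩
    (f := fun p => ⟪e, p⟫) (by fun_prop)
  obtain ⟨k₁, hk₁, hmin⟩ := hcpt.exists_isMinOn ⟨a, ha, ha₁⟩
    (f := fun p => ⟪e, p⟫) (by fun_prop)
  have hmax' : ∀ p ∈ subgrad u x ∩ closure P₁, ⟪e, p⟫ ≤ ⟪e, p₀⟫ := fun p hp => hmax hp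
  have hmin' : ∀ p ∈ subgrad u x ∩ closure P₁, ⟪e, k₁⟫ ≤ ⟪e, p⟫ := fun p hp => hmin hp
  have hw0 : 0 < ⟪e, p₀ - k₁⟫ := by
    rw [inner_sub_right] at hev ⊢
    rcases lt_or_gt_of_ne (sub_ne_zero.1 hev) with h | h
    · linarith [hmin' c hc, hmax' c' hc']
    · linarith [hmin' c' hc', hmax' c hc]
  set w := ⟪e, p₀ - k₁⟫ with hw
  obtain ⟨r, R, hr0, hrR, hrad⟩ := H.exists_radii hx
  obtain ⟨hr, hR⟩ := hrad x (mem_closedBall_self hr0.le)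
  have hR0 : 0 < R := hr0.trans_le hrR
  obtain ⟨N, hN0, hN⟩ := exists_nat_mul_gt (9 ^ Module.finrank ℝ E)
    (c := (r / (2 * R)) ^ Module.finrank ℝ E * 3⁻¹ ^ Module.finrank ℝ E) (by positivity)
  have hσ0 : 0 < s / (2 * w) := by positivity
  obtain ⟨j₀, -, hj₀⟩ := exists_nat_mul_gt 1 (c := 2 * (s / (2 * w))) (by positivity)
  have hL : (0 : ℝ) < ((j₀ + N : ℕ) : ℝ) := by exact_mod_cast (by omega)
  obtain ⟨τ₁, hτ₁, hlev₁⟩ := H.exists_level hx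
    (V := {p | ⟪e, p - p₀⟫ < 1 / (2 * ((j₀ + N : ℕ) : ℝ)) * w})
    (isOpen_lt (by fun_prop) continuous_const) fun p hp => by
      have h1 := hmax' p hp
      have h2 : 0 < 1 / (2 * ((j₀ + N : ℕ) : ℝ)) * w := by positivity
      rw [mem_ofPred_eq, inner_sub_right]
      linarith
  obtain ⟨τ₂, hτ₂, hlev₂⟩ := H.symm.exists_level hx
    (V := {p | ⟪e, p - p₀⟫ < -(s / (2 * w) * w)})
    (isOpen_lt (by fun_prop) continuous_const) fun p hp => by
      have h1 := hsep p hp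
      have h2 := hmax' a ⟨ha, ha₁⟩
      have h3 : s / (2 * w) * w = s / 2 := by field_simp
      rw [inner_sub_right] at h1
      rw [mem_ofPred_eq, inner_sub_right, h3]
      linarith
  obtain ⟨M, hM⟩ := H.bounded_right.exists_norm_le
  obtain ⟨h, hh, hh₁, hh₂, hh₃⟩ := exists_pos_mul_le 9 (4 * ((j₀ + N : ℕ) : ℝ) / w * ‖e‖)
    (4 + 8 * ((j₀ + N : ℕ) : ℝ) * (‖e‖ * (M + ‖p₀‖)) / w) hτ₁ (half_pos hr0) hτ₂
  have gp₀ := (H.fenchelGap_eq_zero hx).2 hp₀.1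
  have gk₁ := (H.fenchelGap_eq_zero hx).2 hk₁.1
  obtain ⟨p, hp, hpg, hpe⟩ := H.exists_growth_left hr0 hrR hr hR hp₀.2 hk₁.2 (gp₀.trans_le hh.le)
    (gk₁.trans_le hh.le) hh hw.symm hw0 j₀ N hN0 (le_trans (le_of_eq (by ring)) hh₂) hp₀.2 gp₀ hN
    (σ := s / (2 * w)) (τ := τ₂) (M := M + ‖p₀‖) (by linarith) hσ0
    (fun p hp hpg => le_of_lt (hlev₂ p (subset_closure hp) hpg))
    (fun p hp => (norm_sub_le _ _).trans (by gcongr; exact hM p hp))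
    (le_trans (le_of_eq (by ring)) hh₃)
  exact lt_asymm hpe (hlev₁ p (subset_closure hp) (by linarith))

/-- The subgradients in the two closed pieces do not coincide when there are several of them. -/
lemma subsingleton_of_eq (H : IsTransportPotential μ Ω P₁ P₂ u) (hx : x ∈ Ω)
    (heq : subgrad u x ∩ closure P₁ = subgrad u x ∩ closure P₂) :
    (subgrad u x ∩ closure P₁).Subsingleton := by
  intro c hc c' hc'
  by_contra hne
  set e := c - c' with he
  have hcpt := H.isCompact_subgrad_inter x
  obtain ⟨p₀, hp₀, hmax⟩ := hcpt.exists_isMaxOn ⟨c, hc⟩ (f := fun p => ⟪e, p⟫) (by fun_prop)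
  have hmax' : ∀ p ∈ subgrad u x ∩ closure P₁, ⟪e, p⟫ ≤ ⟪e, p₀⟫ := fun p hp => hmax hp
  have hw0 : 0 < ⟪e, p₀ - c'⟫ := by
    have h1 : 0 < ⟪e, c - c'⟫ := by
      rw [← he, real_inner_self_eq_norm_sq]
      have := norm_pos_iff.2 (sub_ne_zero.2 hne)
      positivity
    have h2 := hmax' c hc
    rw [inner_sub_right] at h1 ⊢
    linarith
  set w := ⟪e, p₀ - c'⟫ with hw
  obtain ⟨r, R, hr0, hrR, hrad⟩ := H.exists_radii hx
  obtain ⟨hr, hR⟩ := hrad x (mem_closedBall_self hr0.le)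
  have hR0 : 0 < R := hr0.trans_le hrR
  obtain ⟨N, hN0, hN⟩ := exists_nat_mul_gt (2 * 9 ^ Module.finrank ℝ E)
    (c := (r / (2 * R)) ^ Module.finrank ℝ E * 3⁻¹ ^ Module.finrank ℝ E) (by positivity)
  have hNr : (0 : ℝ) < N := by exact_mod_cast hN0
  have hV : IsOpen {p : E | ⟪e, p - p₀⟫ < 1 / (2 * (N : ℝ)) * w} :=
    isOpen_lt (by fun_prop) continuous_const
  have hsubV : subgrad u x ∩ closure P₁ ⊆ {p : E | ⟪e, p - p₀⟫ < 1 / (2 * (N : ℝ)) * w} := by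
    intro p hp
    have h1 := hmax' p hp
    have h2 : 0 < 1 / (2 * (N : ℝ)) * w := by positivity
    rw [mem_ofPred_eq, inner_sub_right]
    linarith
  obtain ⟨τ₁, hτ₁, hlev₁⟩ := H.exists_level hx hV hsubV
  obtain ⟨τ₂, hτ₂, hlev₂⟩ := H.symm.exists_level hx hV (heq ▸ hsubV)
  obtain ⟨h, hh, hh₁, hh₂, hh₃⟩ := exists_pos_mul_le 9 (4 * (N : ℝ) / w * ‖e‖)
    9 hτ₁ (half_pos hr0) hτ₂
  have gp₀ := (H.fenchelGap_eq_zero hx).2 hp₀.1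
  have gc' := (H.fenchelGap_eq_zero hx).2 hc'.1
  have hp₀' := heq ▸ hp₀
  have hc₂ := heq ▸ hc'
  have hfin : ∀ p ∈ P₁ ∪ P₂, fenchelGap Ω u x p ≤ 9 * h →
      ¬ (1 / (2 * (N : ℝ)) * w < ⟪e, p - p₀⟫) := by
    rintro p (hp | hp) hpg hpe
    · exact lt_asymm hpe (hlev₁ p (subset_closure hp) (by linarith))
    · exact lt_asymm hpe (hlev₂ p (subset_closure hp) (by linarith))
  have hs : 4 * h * (N : ℝ) / w * ‖e‖ ≤ r / 2 := le_trans (le_of_eq (by ring)) hh₂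
  rcases le_total (μ {p ∈ P₂ | fenchelGap Ω u x p ≤ h}) (μ {p ∈ P₁ | fenchelGap Ω u x p ≤ h})
    with hle | hle
  · obtain ⟨p, hp, hpg, hpe⟩ := H.exists_growth_union hr0 hrR hr hR hp₀.2 hp₀'.2 hc'.2
      (gp₀.trans_le hh.le) (gc'.trans_le hh.le) hh hw.symm hw0 N hN0 hs hp₀.2 hp₀'.2 gp₀ hN hle
    exact hfin p hp hpg hpe
  · obtain ⟨p, hp, hpg, hpe⟩ := H.symm.exists_growth_union hr0 hrR hr hR hp₀'.2 hp₀.2 hc₂.2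
      (gp₀.trans_le hh.le) (gc'.trans_le hh.le) hh hw.symm hw0 N hN0 hs hp₀'.2 hp₀.2 gp₀ hN hle
    exact hfin p hp.symm hpg hpe

lemma not_subset_of_nontrivial (H : IsTransportPotential μ Ω P₁ P₂ u) (hx : x ∈ Ω)
    (hs : (subgrad u x).Nontrivial) :
    ¬ subgrad u x ∩ closure P₁ ⊆ subgrad u x ∩ closure P₂ := by
  intro hsub
  obtain ⟨s, hs, s', hs', hne⟩ := hs
  obtain ⟨p, hp, hpc, hpm⟩ := H.exists_subgrad_max x (s - s')
  obtain ⟨p', hp', hpc', hpm'⟩ := H.exists_subgrad_max x (-(s - s'))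
  have hmem : ∀ q ∈ subgrad u x, q ∈ closure (P₁ ∪ P₂) → q ∈ subgrad u x ∩ closure P₂ := by
    intro q hq hqc
    rw [closure_union] at hqc
    exact hqc.elim (fun h => hsub ⟨hq, h⟩) fun h => ⟨hq, h⟩
  have hpp : p ≠ p' := by
    rintro rfl
    have h1 := hpm s hs
    have h2 := hpm' s' hs'
    rw [inner_neg_right, inner_neg_right] at h2
    have h3 : 0 < ⟪s - s', s - s'⟫ := by
      rw [real_inner_self_eq_norm_sq]
      have := norm_pos_iff.2 (sub_ne_zero.2 hne)
      positivity
    rw [inner_sub_left] at h3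
    linarith
  by_cases hsub' : subgrad u x ∩ closure P₂ ⊆ subgrad u x ∩ closure P₁
  · exact hpp (H.symm.subsingleton_of_eq hx (hsub'.antisymm hsub) (hmem p hp hpc)
      (hmem p' hp' hpc'))
  · obtain ⟨a, ha, ha'⟩ := not_subset.1 hsub'
    exact hpp (H.symm.subsingleton_of_notMem hx ha.1 ha.2 (fun h => ha' ⟨ha.1, h⟩)
      (hmem p hp hpc) (hmem p' hp' hpc'))

/-- At a singular point there is exactly one subgradient in each closed piece. -/
lemma exists_pair (H : IsTransportPotential μ Ω P₁ P₂ u) (hx : x ∈ Ω)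
    (hd : ¬ DifferentiableAt ℝ u x) :
    ∃ a b, a ≠ b ∧ subgrad u x ∩ closure P₁ = {a} ∧ subgrad u x ∩ closure P₂ = {b} := by
  have hs : (subgrad u x).Nontrivial := by
    by_contra h
    exact hd (H.differentiableAt_of_subgrad_subsingleton (not_nontrivial_iff.1 h))
  obtain ⟨a, ha, ha'⟩ := not_subset.1 (H.not_subset_of_nontrivial hx hs)
  obtain ⟨b, hb, hb'⟩ := not_subset.1 (H.symm.not_subset_of_nontrivial hx hs)
  refine ⟨a, b, fun h => ha' (h ▸ hb), ?_, ?_⟩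
  · exact (H.subsingleton_of_notMem hx ha.1 ha.2 fun h => ha' ⟨ha.1, h⟩).eq_singleton_of_mem ha
  · exact (H.symm.subsingleton_of_notMem hx hb.1 hb.2
      fun h => hb' ⟨hb.1, h⟩).eq_singleton_of_mem hb

end IsTransportPotential

namespace IsTransportPotential

variable {E : Type*} [NormedAddCommGroup E] [InnerProductSpace ℝ E] [FiniteDimensional ℝ E]
  [CompleteSpace E] [MeasurableSpace E] [BorelSpace E] {μ : Measure E} [μ.IsAddHaarMeasure]
  {Ω P₁ P₂ : Set E} {u : E → ℝ} {x x₀ a b : E}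

/-- The low-level sets of the gap stay close to the subgradients, uniformly in the base point. -/
lemma exists_uniform_level (H : IsTransportPotential μ Ω P₁ P₂ u) (hx₀ : x₀ ∈ Ω) {V : Set E}
    (hV : IsOpen V) (hsub : subgrad u x₀ ∩ closure P₁ ⊆ V) :
    ∃ δ > 0, ∃ τ > 0, ∀ x ∈ ball x₀ δ, ∀ p ∈ closure P₁, fenchelGap Ω u x p ≤ τ → p ∈ V := by
  obtain ⟨τ, hτ, hlev⟩ := H.exists_level hx₀ hV hsub
  obtain ⟨M, hM⟩ := H.bounded_left.closure.exists_norm_le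
  obtain ⟨δ₁, hδ₁, hu⟩ := Metric.continuous_iff.1 H.continuous x₀ (τ / 4) (by positivity)
  obtain ⟨δ₂, hδ₂, hMδ, -, -⟩ := exists_pos_mul_le M 0 0 (b₁ := τ / 4) (by positivity) one_pos
    one_pos
  refine ⟨min δ₁ δ₂, lt_min hδ₁ hδ₂, τ / 2, half_pos hτ, fun x hx p hp hg => hlev p hp ?_⟩
  have hx' := mem_ball.1 hx
  have h1 := hu x (hx'.trans_le (min_le_left _ _))
  rw [Real.dist_eq, abs_lt] at h1
  have h2 : ⟪p, x - x₀⟫ ≤ τ / 4 := by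
    have hM0 : 0 ≤ M := (norm_nonneg p).trans (hM p hp)
    refine (real_inner_le_norm _ _).trans (le_trans ?_ hMδ)
    rw [mul_comm]
    refine mul_le_mul ?_ (hM p hp) (norm_nonneg _) hδ₂.le
    rw [← dist_eq_norm]
    exact hx'.le.trans (min_le_right _ _)
  have h3 := fenchelGap_sub Ω u x₀ x p
  linarith [h1.1]

set_option maxHeartbeats 1000000 in
/-- Selections of the subgradients in one closed piece are Hölder continuous near a point where
they are separated from the subgradients in the other piece. -/
lemma exists_holder_left (H : IsTransportPotential μ Ω P₁ P₂ u) (hx₀ : x₀ ∈ Ω) (hab : a ≠ b)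
    (ha : subgrad u x₀ ∩ closure P₁ = {a}) (hb : subgrad u x₀ ∩ closure P₂ = {b}) :
    ∃ δ > 0, ∃ α ∈ Ioo (0 : ℝ) 1, ∃ C ≥ 0, ∀ x ∈ ball x₀ δ, ∀ x' ∈ ball x₀ δ, x ≠ x' →
      ∀ p ∈ subgrad u x ∩ closure P₁, ∀ p' ∈ subgrad u x' ∩ closure P₁,
        ‖p - p'‖ ≤ C * ‖x - x'‖ ^ α := by
  have hv0 : 0 < ‖b - a‖ := norm_pos_iff.2 (sub_ne_zero.2 hab.symm)
  set v := b - a with hv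
  set ε := ‖v‖ / 12 with hε
  have hε0 : 0 < ε := by positivity
  obtain ⟨δ₁, hδ₁, τ₁, hτ₁, hlev₁⟩ := H.exists_uniform_level hx₀ (isOpen_ball (x := a) (ε := ε))
    (by rw [ha]; simpa using hε0)
  obtain ⟨δ₂, hδ₂, τ₂, hτ₂, hlev₂⟩ := H.symm.exists_uniform_level hx₀
    (isOpen_ball (x := b) (ε := ε)) (by rw [hb]; simpa using hε0)
  obtain ⟨r, R, hr0, hrR, hrad⟩ := H.exists_radii hx₀
  have hR0 : 0 < R := hr0.trans_le hrR
  obtain ⟨N, hN0, hN⟩ := exists_nat_mul_gt (9 ^ Module.finrank ℝ E)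
    (c := (r / (2 * R)) ^ Module.finrank ℝ E * 3⁻¹ ^ Module.finrank ℝ E) (by positivity)
  set L : ℝ := ((1 + N : ℕ) : ℝ) with hLdef
  have hL1 : 1 < L := by rw [hLdef]; exact_mod_cast (by omega)
  have hL : 0 < L := by linarith
  set η : ℝ := 1 / (2 * L) with hη
  have hη0 : 0 < η := by positivity
  have hη1 : η < 1 := by rw [hη, div_lt_one (by positivity)]; linarith
  obtain ⟨M₁, hM₁0, hM₁⟩ := H.bounded_left.closure.exists_pos_norm_le
  obtain ⟨M₂, hM₂0, hM₂⟩ := H.bounded_right.closure.exists_pos_norm_le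
  obtain ⟨κ, hκ0, hκ₁, hκ₂, hκ₃⟩ := exists_pos_mul_le (12 * L) (9 * (2 * M₁))
    (4 * (2 * M₁) + 24 * L * (M₂ + M₁)) (half_pos hr0) hτ₁ hτ₂
  have h9 : (0 : ℝ) < Real.log 9 := Real.log_pos (by norm_num)
  set α : ℝ := Real.log (1 + η) / Real.log 9 with hα
  have hα0 : 0 < α := div_pos (Real.log_pos (by linarith)) h9
  have hα1 : α < 1 := by
    rw [hα, div_lt_one h9]
    exact Real.log_lt_log (by linarith) (by linarith)
  have hηα : (9 : ℝ) ^ α = 1 + η := by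
    rw [Real.rpow_def_of_pos (by norm_num), hα, mul_div_cancel₀ _ h9.ne',
      Real.exp_log (by linarith)]
  refine ⟨min (min δ₁ δ₂) (min r (κ / 2)), by positivity, α, ⟨hα0, hα1⟩,
    6 * M₁ * κ⁻¹ ^ α, by positivity, fun x hx x' hx' hne p hp p' hp' => ?_⟩
  have hxd := mem_ball.1 hx
  have hxd' := mem_ball.1 hx'
  simp only [lt_min_iff] at hxd hxd'
  obtain ⟨hr, hR⟩ := hrad x (mem_closedBall.2 hxd.2.1.le)
  obtain ⟨hr', -⟩ := hrad x' (mem_closedBall.2 hxd'.2.1.le)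
  have hxΩ : x ∈ Ω := hr (mem_closedBall_self hr0.le)
  have hxΩ' : x' ∈ Ω := hr' (mem_closedBall_self hr0.le)
  replace hlev₁ := hlev₁ x (mem_ball.2 hxd.1.1)
  replace hlev₂ := hlev₂ x (mem_ball.2 hxd.1.2)
  set d := ‖x - x'‖ with hd
  have hd0 : 0 < d := norm_pos_iff.2 (sub_ne_zero.2 hne)
  have hdκ : d ≤ κ := by
    have := dist_triangle_right x x' x₀
    rw [dist_eq_norm] at this
    linarith [hxd.2.2, hxd'.2.2]
  rcases eq_or_ne p p' with hpp | hpp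
  · rw [hpp, sub_self, norm_zero]; positivity
  set ρ := ‖p - p'‖ with hρ
  have hρ0 : 0 < ρ := norm_pos_iff.2 (sub_ne_zero.2 hpp)
  have hρM : ρ ≤ 2 * M₁ := by
    refine (norm_sub_le _ _).trans ?_
    linarith [hM₁ p hp.2, hM₁ p' hp'.2]
  have gp : fenchelGap Ω u x p = 0 := (H.fenchelGap_eq_zero hxΩ).2 hp.1
  have gp' : fenchelGap Ω u x p' ≤ ρ * d := by
    rw [fenchelGap_eq H.bounded_source H.continuous x hxΩ' hp'.1]
    have h1 := hp.1 x'
    have h2 : ⟪p', x' - x⟫ - ⟪p, x' - x⟫ ≤ ρ * d := by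
      rw [← inner_sub_left, hρ, hd, norm_sub_rev p, norm_sub_rev x]
      exact real_inner_le_norm _ _
    linarith
  obtain ⟨q₀, q₁, hq₀, hq₁, gq₀, gq₁, hqv, hqρ⟩ : ∃ q₀ q₁, q₀ ∈ closure P₁ ∧ q₁ ∈ closure P₁ ∧
      fenchelGap Ω u x q₀ ≤ ρ * d ∧ fenchelGap Ω u x q₁ ≤ ρ * d ∧ ⟪q₀ - q₁, v⟫ ≤ 0 ∧
      ‖q₀ - q₁‖ = ρ := by
    have gp0 : fenchelGap Ω u x p ≤ ρ * d := by rw [gp]; positivity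
    rcases le_total ⟪p - p', v⟫ 0 with h | h
    · exact ⟨p, p', hp.2, hp'.2, gp0, gp', h, rfl⟩
    · refine ⟨p', p, hp'.2, hp.2, gp', gp0, ?_, norm_sub_rev _ _⟩
      rw [← neg_sub, inner_neg_left]
      linarith
  set e : E := ρ⁻¹ • (q₀ - q₁) - (2 * ‖v‖)⁻¹ • v with he
  have hev : ⟪e, v⟫ ≤ -(6 * ε) := by
    rw [he, inner_sub_left, real_inner_smul_left, real_inner_smul_left, real_inner_self_eq_norm_sq]
    have h1 : ρ⁻¹ * ⟪q₀ - q₁, v⟫ ≤ 0 := mul_nonpos_of_nonneg_of_nonpos (by positivity) hqv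
    have h2 : (2 * ‖v‖)⁻¹ * ‖v‖ ^ 2 = 6 * ε := by rw [hε]; field_simp; norm_num
    linarith
  have he1 : ‖e‖ ≤ 3 / 2 := by
    refine (norm_sub_le _ _).trans ?_
    rw [norm_smul, norm_smul, hqρ, norm_inv, norm_inv, Real.norm_of_nonneg hρ0.le,
      Real.norm_of_nonneg (by positivity), inv_mul_cancel₀ hρ0.ne', mul_inv, mul_assoc,
      inv_mul_cancel₀ hv0.ne']
    norm_num
  have heq : ρ / 2 ≤ ⟪e, q₀ - q₁⟫ := by
    rw [he, inner_sub_left, real_inner_smul_left, real_inner_smul_left, real_inner_self_eq_norm_sq,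
      hqρ]
    have h1 : ρ⁻¹ * ρ ^ 2 = ρ := by field_simp
    have h2 : (2 * ‖v‖)⁻¹ * ⟪v, q₀ - q₁⟫ ≤ 0 := by
      rw [real_inner_comm]
      exact mul_nonpos_of_nonneg_of_nonpos (by positivity) hqv
    linarith
  have hiter : ∀ k : ℕ, 9 ^ k * d ≤ 9 * κ → ∃ q ∈ closure P₁, ∃ q' ∈ closure P₁,
      fenchelGap Ω u x q ≤ 9 ^ k * (ρ * d) ∧ fenchelGap Ω u x q' ≤ 9 ^ k * (ρ * d) ∧
      (1 + η) ^ k * (ρ / 2) ≤ ⟪e, q - q'⟫ := by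
    intro k
    induction k with
    | zero => exact fun _ => ⟨q₀, hq₀, q₁, hq₁, by simpa using gq₀, by simpa using gq₁,
        by simpa using heq⟩
    | succ k ih =>
      intro hk
      rw [pow_succ] at hk
      have hkκ : 9 ^ k * d ≤ κ := by linarith
      obtain ⟨q, hq, q', hq', gq, gq', hqq⟩ := ih (by linarith)
      set h := 9 ^ k * (ρ * d) with hh
      have hh0 : 0 < h := by positivity
      have hhκ : h ≤ κ * ρ := by
        calc h = 9 ^ k * d * ρ := by rw [hh]; ring
          _ ≤ _ := by gcongr
      set w := ⟪e, q - q'⟫ with hw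
      have hwρ : ρ / 2 ≤ w := by
        refine le_trans ?_ hqq
        have : 1 ≤ (1 + η) ^ k := one_le_pow₀ (by linarith)
        nlinarith
      have hw0 : 0 < w := by linarith
      have hhw : h / w ≤ 2 * κ := by
        rw [div_le_iff₀ hw0]
        calc h ≤ κ * ρ := hhκ
          _ = 2 * κ * (ρ / 2) := by ring
          _ ≤ _ := by gcongr
      have hh9 : 9 * h ≤ τ₁ := by
        calc 9 * h ≤ 9 * (κ * (2 * M₁)) := by gcongr; exact hhκ.trans (by gcongr)
          _ = κ * (9 * (2 * M₁)) := by ring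
          _ ≤ τ₁ := hκ₂
      have hqa := mem_ball_iff_norm.1 (hlev₁ q hq (by linarith))
      have hqa' := mem_ball_iff_norm.1 (hlev₁ q' hq' (by linarith))
      have hw3 : w ≤ 3 * ε := by
        have h1 : ‖q - q'‖ ≤ 2 * ε := by
          have := norm_sub_le (q - a) (q' - a)
          rw [sub_sub_sub_cancel_right] at this
          linarith
        calc w ≤ ‖e‖ * ‖q - q'‖ := real_inner_le_norm _ _
          _ ≤ 3 / 2 * (2 * ε) := by gcongr
          _ = 3 * ε := by ring
      have hs : 4 * h * L / w * ‖e‖ ≤ r / 2 := by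
        calc 4 * h * L / w * ‖e‖ = 4 * (h / w) * L * ‖e‖ := by ring
          _ ≤ 4 * (2 * κ) * L * (3 / 2) := by gcongr
          _ = κ * (12 * L) := by ring
          _ ≤ _ := hκ₁
      have hτ : 4 * h + 8 * L * h * (‖e‖ * (M₂ + M₁)) / w ≤ τ₂ := by
        calc _ = 4 * h + 8 * L * (h / w) * (‖e‖ * (M₂ + M₁)) := by ring
          _ ≤ 4 * (κ * (2 * M₁)) + 8 * L * (2 * κ) * (3 / 2 * (M₂ + M₁)) := by
            gcongr
            exact hhκ.trans (by gcongr)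
          _ = κ * (4 * (2 * M₁) + 24 * L * (M₂ + M₁)) := by ring
          _ ≤ τ₂ := hκ₃
      have hex : ∀ z ∈ P₂, fenchelGap Ω u x z ≤ τ₂ → ⟪e, z - q⟫ ≤ -(1 * w) := by
        intro z hz gz
        have hzb := mem_ball_iff_norm.1 (hlev₂ z (subset_closure hz) gz)
        have h1 : z - q = v + ((z - b) - (q - a)) := by rw [hv]; abel
        have h2 : ⟪e, (z - b) - (q - a)⟫ ≤ 3 * ε := by
          have h3 : ‖(z - b) - (q - a)‖ ≤ 2 * ε := by
            have := norm_sub_le (z - b) (q - a)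
            linarith
          calc _ ≤ ‖e‖ * ‖(z - b) - (q - a)‖ := real_inner_le_norm _ _
            _ ≤ 3 / 2 * (2 * ε) := by gcongr
            _ = 3 * ε := by ring
        rw [h1, inner_add_right]
        linarith
      obtain ⟨z, hz, gz, hez⟩ := H.exists_growth_left hr0 hrR hr hR hq hq' gq gq' hh0 hw.symm hw0
        1 N hN0 hs hp.2 gp hN (σ := 1) (τ := τ₂) (M := M₂ + M₁) (by norm_num) one_pos hex
        (fun z hz => (norm_sub_le _ _).trans
          (add_le_add (hM₂ z (subset_closure hz)) (hM₁ q hq))) hτ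
      refine ⟨z, subset_closure hz, q', hq', gz.trans (le_of_eq (by rw [hh]; ring)),
        gq'.trans ?_, ?_⟩
      · rw [hh, pow_succ]; nlinarith
      · have h1 : z - q' = (z - q) + (q - q') := by abel
        rw [h1, inner_add_right, ← hw, pow_succ]
        change η * w < _ at hez
        calc (1 + η) ^ k * (1 + η) * (ρ / 2) = (1 + η) * ((1 + η) ^ k * (ρ / 2)) := by ring
          _ ≤ (1 + η) * w := by gcongr
          _ ≤ _ := by linarith
  obtain ⟨k, hk, hk'⟩ := exists_nat_pow_near (x := 9 * κ / d) (y := 9)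
    (by rw [one_le_div hd0]; linarith) (by norm_num)
  obtain ⟨q, hq, q', hq', -, -, hqq⟩ := hiter k (by rwa [le_div_iff₀ hd0] at hk)
  have h1 : (1 + η) ^ k * (ρ / 2) ≤ 3 / 2 * (2 * M₁) := by
    refine hqq.trans ((real_inner_le_norm _ _).trans ?_)
    gcongr
    exact (norm_sub_le _ _).trans (by linarith [hM₁ q hq, hM₁ q' hq'])
  have h2 : (κ / d) ^ α ≤ (1 + η) ^ k := by
    rw [← hηα, ← Real.rpow_natCast, ← Real.rpow_mul (by norm_num), mul_comm,
      Real.rpow_mul (by norm_num), Real.rpow_natCast]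
    gcongr
    rw [pow_succ, mul_div_assoc, mul_comm] at hk'
    linarith
  have h3 : (κ / d) ^ α * ρ ≤ 6 * M₁ := by
    have := mul_le_mul_of_nonneg_right h2 hρ0.le
    linarith
  rw [mul_assoc, ← Real.mul_rpow (by positivity) hd0.le]
  have h4 : κ⁻¹ * d = (κ / d)⁻¹ := by rw [inv_div]; ring
  rw [h4, Real.inv_rpow (by positivity), ← div_eq_mul_inv, le_div_iff₀ (by positivity)]
  linarith

end IsTransportPotential

section Extension

variable {F : Type*} [NormedAddCommGroup F] [InnerProductSpace ℝ F]

lemma norm_smul_sub_smul_le {χ : F → ℝ} {v : F → F} {B : Set F} {α K₁ K₂ C₁ C₂ : ℝ}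
    (hK₁ : ∀ t ∈ B, |χ t| ≤ K₁) (hK₂ : ∀ t ∈ B, ‖v t‖ ≤ K₂)
    (hC₁ : ∀ s ∈ B, ∀ t ∈ B, |χ s - χ t| ≤ C₁ * ‖s - t‖ ^ α)
    (hC₂ : ∀ s ∈ B, ∀ t ∈ B, ‖v s - v t‖ ≤ C₂ * ‖s - t‖ ^ α) {s t : F} (hs : s ∈ B) (ht : t ∈ B) :
    ‖χ s • v s - χ t • v t‖ ≤ (K₁ * C₂ + C₁ * K₂) * ‖s - t‖ ^ α := by
  have h : χ s • v s - χ t • v t = χ s • (v s - v t) + (χ s - χ t) • v t := by module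
  rw [h]
  refine (norm_add_le _ _).trans ?_
  rw [norm_smul, norm_smul, Real.norm_eq_abs, Real.norm_eq_abs, add_mul]
  refine add_le_add ?_ ?_
  · rw [mul_assoc]
    exact mul_le_mul (hK₁ s hs) (hC₂ s hs t ht) (norm_nonneg _)
      ((abs_nonneg _).trans (hK₁ s hs))
  · rw [mul_assoc, mul_comm K₂, ← mul_assoc]
    exact mul_le_mul (hC₁ s hs t ht) (hK₂ t ht) (norm_nonneg _)
      ((abs_nonneg _).trans (hC₁ s hs t ht))

lemma norm_sub_le_rpow {ρ α : ℝ} (hα1 : α < 1) {s t : F} (hs : s ∈ ball (0 : F) ρ)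
    (ht : t ∈ ball (0 : F) ρ) : ‖s - t‖ ≤ (2 * ρ) ^ (1 - α) * ‖s - t‖ ^ α := by
  rw [mem_ball_zero_iff] at hs ht
  rcases (norm_nonneg (s - t)).eq_or_lt with h0 | h0
  · rw [← h0]
    have : 0 ≤ ρ := (norm_nonneg s).trans hs.le
    positivity
  · have h1 : ‖s - t‖ ≤ 2 * ρ := (norm_sub_le _ _).trans (by linarith)
    calc ‖s - t‖ = ‖s - t‖ ^ (1 - α) * ‖s - t‖ ^ α := by
          rw [← Real.rpow_add h0, sub_add_cancel, Real.rpow_one]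
      _ ≤ _ := by
          gcongr

/-- A function which is `C^{1,α}` on a ball agrees on a smaller ball with a globally `C^{1,α}`
function. -/
lemma exists_holder_gradient_extension [FiniteDimensional ℝ F] [CompleteSpace F] {g : F → ℝ}
    {v : F → F}
    {ρ α B C : ℝ} (hρ : 0 < ρ) (hα0 : 0 < α) (hα1 : α < 1) (hC : 0 ≤ C)
    (hB : ∀ t ∈ ball (0 : F) ρ, |g t| ≤ B)
    (hg1 : ∀ s ∈ ball (0 : F) ρ, ∀ t ∈ ball (0 : F) ρ, |g s - g t| ≤ ‖s - t‖)
    (hgv : ∀ t ∈ ball (0 : F) ρ, HasGradientAt g (v t) t)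
    (hv : ∀ s ∈ ball (0 : F) ρ, ∀ t ∈ ball (0 : F) ρ, ‖v s - v t‖ ≤ C * ‖s - t‖ ^ α) :
    ∃ G : F → ℝ, Differentiable ℝ G ∧
      (∃ C' : ℝ, ∀ s t, ‖gradient G s - gradient G t‖ ≤ C' * ‖s - t‖ ^ α) ∧
      ∀ t ∈ ball (0 : F) (ρ / 2), G t = g t := by
  let χ : ContDiffBump (0 : F) := ⟨ρ / 2, 3 * ρ / 4, by positivity, by linarith⟩
  have hχc : ContDiff ℝ 2 χ := χ.contDiff
  have hd1 : ContDiff ℝ 1 (gradient χ) :=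
    (InnerProductSpace.toDual ℝ F).symm.contDiff.comp (hχc.fderiv_right (m := 1) (by norm_num))
  have hsupp : HasCompactSupport (gradient χ) := by
    have : HasCompactSupport (fderiv ℝ χ) := χ.hasCompactSupport.fderiv (𝕜 := ℝ)
    exact this.comp_left (g := (InnerProductSpace.toDual ℝ F).symm) (map_zero _)
  obtain ⟨L₁, hL₁⟩ := hχc.lipschitzWith_of_hasCompactSupport χ.hasCompactSupport two_ne_zero
  obtain ⟨L₂, hL₂⟩ := hd1.lipschitzWith_of_hasCompactSupport hsupp one_ne_zero
  obtain ⟨K, hK⟩ := hd1.continuous.bounded_above_of_compact_support hsupp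
  have hχg : ∀ t, HasGradientAt χ (gradient χ t) t := fun t =>
    (hχc.differentiable two_ne_zero t).hasGradientAt
  set w : F → F := fun t => χ t • v t + g t • gradient χ t with hw
  have hout : ∀ t ∉ closedBall (0 : F) (3 * ρ / 4), χ =ᶠ[nhds t] 0 := fun t ht =>
    notMem_tsupport_iff_eventuallyEq.1 (by rwa [χ.tsupport_eq])
  have hw0 : ∀ t ∉ closedBall (0 : F) (3 * ρ / 4), w t = 0 := by
    intro t ht
    have h1 : gradient χ t = 0 := by
      rw [gradient, (hout t ht).fderiv_eq]
      simp
    have h2 : χ t = 0 := (hout t ht).eq_of_nhds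
    simp [hw, h1, h2]
  have hGw : ∀ t, HasGradientAt (fun z => χ z * g z) (w t) t := by
    intro t
    by_cases ht : t ∈ closedBall (0 : F) (3 * ρ / 4)
    · have ht' : t ∈ ball (0 : F) ρ := closedBall_subset_ball (by linarith) ht
      have h1 := (hχg t).hasFDerivAt.mul (hgv t ht').hasFDerivAt
      rw [hasGradientAt_iff_hasFDerivAt]
      refine HasFDerivAt.congr_fderiv (f' := χ t • InnerProductSpace.toDual ℝ F (v t) +
        g t • InnerProductSpace.toDual ℝ F (gradient χ t)) h1 ?_
      simp [hw]
    · rw [hw0 t ht]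
      have h1 : (fun z => χ z * g z) =ᶠ[nhds t] fun _ => 0 := by
        filter_upwards [hout t ht] with z hz
        simp [hz]
      exact (hasGradientAt_const t (0 : ℝ)).congr_of_eventuallyEq h1
  have hρα : 0 ≤ (2 * ρ) ^ (1 - α) := by positivity
  have h0 : (0 : F) ∈ ball (0 : F) ρ := mem_ball_self hρ
  have hV : ∀ t ∈ ball (0 : F) ρ, ‖v t‖ ≤ ‖v 0‖ + C * ρ ^ α := by
    intro t ht
    have h1 := hv t ht 0 h0
    rw [sub_zero] at h1
    have h2 : ‖t‖ ^ α ≤ ρ ^ α := by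
      have := (mem_ball_zero_iff.1 ht).le
      gcongr
    have h3 := norm_le_insert' (v t) (v 0)
    nlinarith
  have hχ1 : ∀ t ∈ ball (0 : F) ρ, |χ t| ≤ 1 := fun t _ => by
    rw [abs_of_nonneg χ.nonneg]; exact χ.le_one
  have hχh : ∀ s ∈ ball (0 : F) ρ, ∀ t ∈ ball (0 : F) ρ,
      |χ s - χ t| ≤ (L₁ * (2 * ρ) ^ (1 - α)) * ‖s - t‖ ^ α := by
    intro s hs t ht
    rw [mul_assoc, ← Real.norm_eq_abs]
    refine (hL₁.norm_sub_le s t).trans ?_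
    gcongr
    exact norm_sub_le_rpow hα1 hs ht
  have hgh : ∀ s ∈ ball (0 : F) ρ, ∀ t ∈ ball (0 : F) ρ,
      |g s - g t| ≤ (2 * ρ) ^ (1 - α) * ‖s - t‖ ^ α := fun s hs t ht =>
    (hg1 s hs t ht).trans (norm_sub_le_rpow hα1 hs ht)
  have hχ'h : ∀ s ∈ ball (0 : F) ρ, ∀ t ∈ ball (0 : F) ρ,
      ‖gradient χ s - gradient χ t‖ ≤ (L₂ * (2 * ρ) ^ (1 - α)) * ‖s - t‖ ^ α := by
    intro s hs t ht
    rw [mul_assoc]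
    refine (hL₂.norm_sub_le s t).trans ?_
    gcongr
    exact norm_sub_le_rpow hα1 hs ht
  obtain ⟨D, hD⟩ : ∃ D, ∀ s ∈ ball (0 : F) ρ, ∀ t ∈ ball (0 : F) ρ,
      ‖w s - w t‖ ≤ D * ‖s - t‖ ^ α := by
    refine ⟨(1 * C + L₁ * (2 * ρ) ^ (1 - α) * (‖v 0‖ + C * ρ ^ α)) +
      (B * (L₂ * (2 * ρ) ^ (1 - α)) + (2 * ρ) ^ (1 - α) * K), fun s hs t ht => ?_⟩
    have h1 := norm_smul_sub_smul_le hχ1 hV hχh hv hs ht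
    have h2 := norm_smul_sub_smul_le hB (fun t _ => hK t) hgh hχ'h hs ht
    have h3 : w s - w t = (χ s • v s - χ t • v t) +
        (g s • gradient χ s - g t • gradient χ t) := by
      simp only [hw]; abel
    rw [h3]
    refine (norm_add_le _ _).trans ((add_le_add h1 h2).trans_eq ?_)
    rw [← add_mul]
  have hD0 : ∀ s ∈ ball (0 : F) ρ, ∀ t ∈ ball (0 : F) ρ,
      ‖w s - w t‖ ≤ |D| * ‖s - t‖ ^ α := fun s hs t ht =>
    (hD s hs t ht).trans (by gcongr; exact le_abs_self D)
  set W : ℝ := ‖w 0‖ + |D| * ρ ^ α with hWdef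
  have hW0 : 0 ≤ W := by positivity
  have hWb : ∀ t ∈ ball (0 : F) ρ, ‖w t‖ ≤ W := by
    intro t ht
    have h1 := hD0 t ht 0 h0
    rw [sub_zero] at h1
    have h2 : ‖t‖ ^ α ≤ ρ ^ α := by
      have := (mem_ball_zero_iff.1 ht).le
      gcongr
    have h3 := norm_le_insert' (w t) (w 0)
    have h4 := mul_le_mul_of_nonneg_left h2 (abs_nonneg D)
    linarith
  have hcross : ∀ s t, t ∉ ball (0 : F) ρ → ‖w s‖ ≤ W * (ρ / 4)⁻¹ ^ α * ‖s - t‖ ^ α := by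
    intro s t ht
    by_cases hs : s ∈ closedBall (0 : F) (3 * ρ / 4)
    · have hs' : s ∈ ball (0 : F) ρ := closedBall_subset_ball (by linarith) hs
      rw [mem_closedBall_zero_iff] at hs
      rw [mem_ball_zero_iff, not_lt] at ht
      have h1 : ρ / 4 ≤ ‖s - t‖ := by
        have := norm_sub_norm_le t s
        rw [norm_sub_rev] at this
        linarith
      rw [mul_assoc, ← Real.mul_rpow (by positivity) (norm_nonneg _)]
      have h2 : 1 ≤ ((ρ / 4)⁻¹ * ‖s - t‖) ^ α := by
        refine Real.one_le_rpow ?_ hα0.le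
        rw [inv_mul_eq_div, one_le_div (by positivity)]
        exact h1
      calc ‖w s‖ ≤ W * 1 := by rw [mul_one]; exact hWb s hs'
        _ ≤ _ := by gcongr
    · rw [hw0 s hs, norm_zero]
      positivity
  have hnot : ∀ t, t ∉ ball (0 : F) ρ → w t = 0 := fun t ht =>
    hw0 t fun h => ht (closedBall_subset_ball (by linarith) h)
  refine ⟨fun z => χ z * g z, fun t => (hGw t).hasFDerivAt.differentiableAt,
    ⟨|D| + W * (ρ / 4)⁻¹ ^ α, fun s t => ?_⟩, fun t ht => ?_⟩
  · rw [(hGw s).gradient, (hGw t).gradient, add_mul]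
    have p1 : 0 ≤ |D| * ‖s - t‖ ^ α := by positivity
    have p2 : 0 ≤ W * (ρ / 4)⁻¹ ^ α * ‖s - t‖ ^ α := by positivity
    by_cases hs : s ∈ ball (0 : F) ρ
    · by_cases ht : t ∈ ball (0 : F) ρ
      · linarith [hD0 s hs t ht]
      · rw [hnot t ht, sub_zero]
        linarith [hcross s t ht]
    · rw [hnot s hs, zero_sub, norm_neg]
      have := hcross t s hs
      rw [norm_sub_rev t s] at this
      linarith
  · have h1 : χ t = 1 := χ.one_of_mem_closedBall (ball_subset_closedBall ht)
    simp [h1]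

end Extension

/-- Near `x₀`, the subgradients of `u` in `K₁` and in `K₂` stay close to `a ≠ b` respectively, and
depend in a Hölder continuous way on the base point. -/
structure IsSubgradSplit {E : Type*} [NormedAddCommGroup E] [InnerProductSpace ℝ E] (u : E → ℝ)
    (K₁ K₂ : Set E) (x₀ a b : E) (δ α C : ℝ) : Prop where
  continuous : Continuous u
  isCompact_left : IsCompact K₁
  isCompact_right : IsCompact K₂
  exists_subgrad : ∀ x, ∃ p ∈ subgrad u x, p ∈ K₁ ∪ K₂
  ne : a ≠ b
  mem_left : a ∈ subgrad u x₀ ∩ K₁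
  mem_right : b ∈ subgrad u x₀ ∩ K₂
  radius_pos : 0 < δ
  exponent_pos : 0 < α
  exponent_lt : α < 1
  const_nonneg : 0 ≤ C
  near_left : ∀ x ∈ ball x₀ δ, ∀ p ∈ subgrad u x ∩ K₁, ‖p - a‖ ≤ ‖a - b‖ / 12
  near_right : ∀ x ∈ ball x₀ δ, ∀ p ∈ subgrad u x ∩ K₂, ‖p - b‖ ≤ ‖a - b‖ / 12
  holder_left : ∀ x ∈ ball x₀ δ, ∀ x' ∈ ball x₀ δ, x ≠ x' → ∀ p ∈ subgrad u x ∩ K₁,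
    ∀ p' ∈ subgrad u x' ∩ K₁, ‖p - p'‖ ≤ C * ‖x - x'‖ ^ α
  holder_right : ∀ x ∈ ball x₀ δ, ∀ x' ∈ ball x₀ δ, x ≠ x' → ∀ p ∈ subgrad u x ∩ K₂,
    ∀ p' ∈ subgrad u x' ∩ K₂, ‖p - p'‖ ≤ C * ‖x - x'‖ ^ α

namespace IsTransportPotential

variable {E : Type*} [NormedAddCommGroup E] [InnerProductSpace ℝ E] [FiniteDimensional ℝ E]
  [CompleteSpace E] [MeasurableSpace E] [BorelSpace E] {μ : Measure E} [μ.IsAddHaarMeasure]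
  {Ω P₁ P₂ : Set E} {u : E → ℝ} {x x₀ a b : E}

lemma exists_radius_near (H : IsTransportPotential μ Ω P₁ P₂ u) (hx₀ : x₀ ∈ Ω)
    (ha : subgrad u x₀ ∩ closure P₁ = {a}) {ε : ℝ} (hε : 0 < ε) :
    ∃ δ > 0, ∀ x ∈ ball x₀ δ, ∀ p ∈ subgrad u x ∩ closure P₁, ‖p - a‖ ≤ ε := by
  obtain ⟨δ, hδ, τ, hτ, h⟩ := H.exists_uniform_level hx₀ (V := ball a ε) isOpen_ball
    (by rw [ha, singleton_subset_iff]; exact mem_ball_self hε)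
  obtain ⟨δ', hδ', hΩ⟩ := Metric.isOpen_iff.1 H.isOpen_source x₀ hx₀
  refine ⟨min δ δ', lt_min hδ hδ', fun x hx p hp => ?_⟩
  have hxΩ := hΩ (ball_subset_ball (min_le_right _ _) hx)
  have := h x (ball_subset_ball (min_le_left _ _) hx) p hp.2
    (((H.fenchelGap_eq_zero hxΩ).2 hp.1).trans_le hτ.le)
  rw [← dist_eq_norm]
  exact (mem_ball.1 this).le

lemma exists_isSubgradSplit (H : IsTransportPotential μ Ω P₁ P₂ u) (hx₀ : x₀ ∈ Ω)
    (hd : ¬ DifferentiableAt ℝ u x₀) :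
    ∃ a b δ α C, ball x₀ δ ⊆ Ω ∧ IsSubgradSplit u (closure P₁) (closure P₂) x₀ a b δ α C := by
  obtain ⟨a, b, hab, ha, hb⟩ := H.exists_pair hx₀ hd
  have hε : 0 < ‖a - b‖ / 12 := by
    have := norm_pos_iff.2 (sub_ne_zero.2 hab)
    positivity
  obtain ⟨δ₁, hδ₁, hn₁⟩ := H.exists_radius_near hx₀ ha hε
  obtain ⟨δ₂, hδ₂, hn₂⟩ := H.symm.exists_radius_near hx₀ hb hε
  obtain ⟨δ₃, hδ₃, α₁, hα₁, C₁, hC₁, hh₁⟩ := H.exists_holder_left hx₀ hab ha hb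
  obtain ⟨δ₄, hδ₄, α₂, hα₂, C₂, hC₂, hh₂⟩ := H.symm.exists_holder_left hx₀ hab.symm hb ha
  obtain ⟨δ₅, hδ₅, hΩ⟩ := Metric.isOpen_iff.1 H.isOpen_source x₀ hx₀
  obtain ⟨δ, hδ, k₁, k₂, k₃, k₄, k₅, k₆⟩ : ∃ δ > 0, δ ≤ δ₁ ∧ δ ≤ δ₂ ∧ δ ≤ δ₃ ∧ δ ≤ δ₄ ∧ δ ≤ δ₅ ∧
      δ ≤ 1 / 2 := by
    refine ⟨min δ₁ (min δ₂ (min δ₃ (min δ₄ (min δ₅ (1 / 2))))), by positivity, ?_⟩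
    simp
  have hrpow : ∀ x ∈ ball x₀ δ, ∀ x' ∈ ball x₀ δ, x ≠ x' → ∀ β γ c d : ℝ, γ ≤ β → 0 ≤ c → c ≤ d →
      c * ‖x - x'‖ ^ β ≤ d * ‖x - x'‖ ^ γ := by
    intro x hx x' hx' hne β γ c d hβ hc hcd
    have h0 : 0 < ‖x - x'‖ := norm_pos_iff.2 (sub_ne_zero.2 hne)
    have h1 : ‖x - x'‖ ≤ 1 := by
      rw [← dist_eq_norm]
      have := dist_triangle_right x x' x₀
      have := mem_ball.1 hx
      have := mem_ball.1 hx'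
      linarith
    exact mul_le_mul hcd (Real.rpow_le_rpow_of_exponent_ge h0 h1 hβ) (by positivity)
      (hc.trans hcd)
  refine ⟨a, b, δ, min α₁ α₂, max C₁ C₂, (ball_subset_ball k₅).trans hΩ, ?_⟩
  exact
    { continuous := H.continuous
      isCompact_left := H.bounded_left.isCompact_closure
      isCompact_right := H.bounded_right.isCompact_closure
      exists_subgrad := fun x => by
        rw [← closure_union]
        exact H.exists_subgrad x
      ne := hab
      mem_left := by rw [ha]; rfl
      mem_right := by rw [hb]; rfl
      radius_pos := hδ
      exponent_pos := lt_min hα₁.1 hα₂.1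
      exponent_lt := (min_le_left _ _).trans_lt hα₁.2
      const_nonneg := hC₁.trans (le_max_left _ _)
      near_left := fun x hx => hn₁ x (ball_subset_ball k₁ hx)
      near_right := fun x hx => hn₂ x (ball_subset_ball k₂ hx)
      holder_left := fun x hx x' hx' hne p hp p' hp' =>
        (hh₁ x (ball_subset_ball k₃ hx) x' (ball_subset_ball k₃ hx') hne p hp p' hp').trans
          (hrpow x hx x' hx' hne _ _ _ _ (min_le_left _ _) hC₁ (le_max_left _ _))
      holder_right := fun x hx x' hx' hne p hp p' hp' =>
        (hh₂ x (ball_subset_ball k₄ hx) x' (ball_subset_ball k₄ hx') hne p hp p' hp').trans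
          (hrpow x hx x' hx' hne _ _ _ _ (min_le_right _ _) hC₂ (le_max_right _ _)) }

end IsTransportPotential

namespace IsSubgradSplit

variable {E : Type*} [NormedAddCommGroup E] [InnerProductSpace ℝ E] {u : E → ℝ}
    {K₁ K₂ : Set E} {x₀ a b : E} {δ α C : ℝ} {y y' p p' q q' : E}

lemma symm (H : IsSubgradSplit u K₁ K₂ x₀ a b δ α C) : IsSubgradSplit u K₂ K₁ x₀ b a δ α C where
  continuous := H.continuous
  isCompact_left := H.isCompact_right
  isCompact_right := H.isCompact_left
  exists_subgrad := by simpa only [union_comm] using H.exists_subgrad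
  ne := H.ne.symm
  mem_left := H.mem_right
  mem_right := H.mem_left
  radius_pos := H.radius_pos
  exponent_pos := H.exponent_pos
  exponent_lt := H.exponent_lt
  const_nonneg := H.const_nonneg
  near_left := by simpa only [norm_sub_rev b a] using H.near_right
  near_right := by simpa only [norm_sub_rev b a] using H.near_left
  holder_left := H.holder_right
  holder_right := H.holder_left

lemma norm_pos (H : IsSubgradSplit u K₁ K₂ x₀ a b δ α C) : 0 < ‖a - b‖ :=
  norm_pos_iff.2 (sub_ne_zero.2 H.ne)

/-- The function is not differentiable at points with subgradients of both kinds. -/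
lemma not_differentiableAt [CompleteSpace E] (H : IsSubgradSplit u K₁ K₂ x₀ a b δ α C)
    (hy : y ∈ ball x₀ δ)
    (hp : p ∈ subgrad u y ∩ K₁) (hq : q ∈ subgrad u y ∩ K₂) : ¬ DifferentiableAt ℝ u y := by
  intro hd
  have h : p = q := by
    rw [eq_gradient_of_mem_subgrad hd hp.1, eq_gradient_of_mem_subgrad hd hq.1]
  have h1 := H.near_left y hy p hp
  have h2 := H.near_right y hy q hq
  have h3 := H.norm_pos
  have h4 := norm_sub_le_norm_sub_add_norm_sub a p b
  rw [norm_sub_rev a p] at h4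
  rw [h] at h1 h4
  linarith

/-- Monotonicity along pairs of singular points: an upper bound in the normal direction. -/
lemma inner_sub_le (H : IsSubgradSplit u K₁ K₂ x₀ a b δ α C) (hy : y ∈ ball x₀ δ)
    (hy' : y' ∈ ball x₀ δ) (hp : p ∈ subgrad u y ∩ K₁) (hq' : q' ∈ subgrad u y' ∩ K₂) :
    ⟪a - b, y' - y⟫ ≤ ‖a - b‖ / 6 * ‖y' - y‖ := by
  have h1 := subgrad_monotone hp.1 hq'.1
  have h2 : ⟪a - b, y' - y⟫ = -⟪p - q', y - y'⟫ + ⟪q' - b, y' - y⟫ - ⟪p - a, y' - y⟫ := by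
    rw [← neg_sub y' y, inner_neg_right]
    simp only [inner_sub_left]
    ring
  have h3 := (real_inner_le_norm (q' - b) (y' - y)).trans
    (mul_le_mul_of_nonneg_right (H.near_right y' hy' q' hq') (norm_nonneg _))
  have h4 := (neg_le_abs _).trans <| (abs_real_inner_le_norm (p - a) (y' - y)).trans
    (mul_le_mul_of_nonneg_right (H.near_left y hy p hp) (norm_nonneg _))
  rw [h2]
  linarith

lemma abs_inner_sub_le (H : IsSubgradSplit u K₁ K₂ x₀ a b δ α C) (hy : y ∈ ball x₀ δ)
    (hy' : y' ∈ ball x₀ δ) (hp : p ∈ subgrad u y ∩ K₁) (hq : q ∈ subgrad u y ∩ K₂)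
    (hp' : p' ∈ subgrad u y' ∩ K₁) (hq' : q' ∈ subgrad u y' ∩ K₂) :
    |⟪a - b, y' - y⟫| ≤ ‖a - b‖ / 6 * ‖y' - y‖ := by
  refine abs_le.2 ⟨?_, H.inner_sub_le hy hy' hp hq'⟩
  have h := H.inner_sub_le hy' hy hp' hq
  rw [norm_sub_rev y y', ← neg_sub y' y, inner_neg_right] at h
  linarith

lemma inner_pair_le (H : IsSubgradSplit u K₁ K₂ x₀ a b δ α C) (hy : y ∈ ball x₀ δ)
    (hy' : y' ∈ ball x₀ δ) (hne : y ≠ y') (hp : p ∈ subgrad u y ∩ K₁)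
    (hq : q ∈ subgrad u y ∩ K₂) (hq' : q' ∈ subgrad u y' ∩ K₂) :
    ⟪p - q, y' - y⟫ ≤ C * ‖y' - y‖ ^ α * ‖y' - y‖ := by
  have h1 := subgrad_monotone hp.1 hq'.1
  have h2 : ⟪p - q, y' - y⟫ = -⟪p - q', y - y'⟫ + ⟪q' - q, y' - y⟫ := by
    rw [← neg_sub y' y, inner_neg_right]
    simp only [inner_sub_left]
    ring
  have h3 := (real_inner_le_norm (q' - q) (y' - y)).trans
    (mul_le_mul_of_nonneg_right (H.holder_right y' hy' y hy hne.symm q' hq' q hq) (norm_nonneg _))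
  rw [h2]
  linarith

lemma abs_inner_pair_le (H : IsSubgradSplit u K₁ K₂ x₀ a b δ α C) (hy : y ∈ ball x₀ δ)
    (hy' : y' ∈ ball x₀ δ) (hne : y ≠ y') (hp : p ∈ subgrad u y ∩ K₁)
    (hq : q ∈ subgrad u y ∩ K₂) (hp' : p' ∈ subgrad u y' ∩ K₁) (hq' : q' ∈ subgrad u y' ∩ K₂) :
    |⟪p - q, y' - y⟫| ≤ C * ‖y' - y‖ ^ α * ‖y' - y‖ := by
  refine abs_le.2 ⟨?_, H.inner_pair_le hy hy' hne hp hq hq'⟩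
  have h := H.symm.inner_pair_le hy hy' hne hq hp hp'
  rw [← neg_sub p q, inner_neg_left] at h
  linarith

/-- Moving away from `x₀` in the direction `a - b` there are no subgradients close to `b`. -/
lemma not_mem_right (H : IsSubgradSplit u K₁ K₂ x₀ a b δ α C) (hy : y ∈ ball x₀ δ)
    (h : ‖a - b‖ / 6 * ‖y - x₀‖ < ⟪a - b, y - x₀⟫) : subgrad u y ∩ K₂ = ∅ := by
  refine eq_empty_of_forall_notMem fun q hq => ?_
  have := H.inner_sub_le (mem_ball_self H.radius_pos) hy H.mem_left hq
  linarith

lemma isClosed_nonempty {K : Set E} (hu : Continuous u) (hK : IsCompact K) :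
    IsClosed {y | (subgrad u y ∩ K).Nonempty} := by
  refine isSeqClosed_iff_isClosed.1 fun ys y hys hlim => ?_
  choose ps hps using hys
  obtain ⟨p, hp, φ, hφ, hpl⟩ := hK.tendsto_subseq fun k => (hps k).2
  exact ⟨p, mem_subgrad_of_tendsto hu (hlim.comp hφ.tendsto_atTop) hpl fun k => (hps (φ k)).1, hp⟩

end IsSubgradSplit

/-- Division of a vector by a scalar is Lipschitz away from vanishing denominators. -/
lemma norm_inv_smul_sub_inv_smul_le {F : Type*} [NormedAddCommGroup F] [NormedSpace ℝ F]
    {m m' c d : ℝ} {w w' : F} (hc : 0 < c) (hm : 5 / 6 * c ≤ m) (hm' : 5 / 6 * c ≤ m')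
    (hw' : ‖w'‖ ≤ 7 / 6 * c)
    (hmd : |m - m'| ≤ d) (hwd : ‖w - w'‖ ≤ d) : ‖m⁻¹ • w - m'⁻¹ • w'‖ ≤ 3 / c * d := by
  have hm0 : 0 < m := by linarith
  have hm0' : 0 < m' := by linarith
  have hd : 0 ≤ d := (abs_nonneg _).trans hmd
  have h1 : m⁻¹ • w - m'⁻¹ • w' = m⁻¹ • (w - w') - (m⁻¹ * (m - m') * m'⁻¹) • w' := by
    have : m⁻¹ * (m - m') * m'⁻¹ = m'⁻¹ - m⁻¹ := by field_simp
    rw [this]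
    module
  have hi : m⁻¹ ≤ 6 / 5 * c⁻¹ := by
    rw [show 6 / 5 * c⁻¹ = (5 / 6 * c)⁻¹ by field_simp]
    exact inv_anti₀ (by positivity) hm
  have hi' : m'⁻¹ ≤ 6 / 5 * c⁻¹ := by
    rw [show 6 / 5 * c⁻¹ = (5 / 6 * c)⁻¹ by field_simp]
    exact inv_anti₀ (by positivity) hm'
  rw [h1]
  refine (norm_sub_le _ _).trans ?_
  rw [norm_smul, norm_smul, Real.norm_eq_abs, Real.norm_eq_abs, abs_mul, abs_mul,
    abs_of_pos (inv_pos.2 hm0), abs_of_pos (inv_pos.2 hm0')]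
  calc m⁻¹ * ‖w - w'‖ + m⁻¹ * |m - m'| * m'⁻¹ * ‖w'‖
      ≤ 6 / 5 * c⁻¹ * d + 6 / 5 * c⁻¹ * d * (6 / 5 * c⁻¹) * (7 / 6 * c) := by gcongr
    _ = 72 / 25 * (c⁻¹ * d) := by field_simp; ring
    _ ≤ 3 / c * d := by
        rw [show 3 / c * d = 3 * (c⁻¹ * d) by field_simp]
        have : 0 ≤ c⁻¹ * d := by positivity
        linarith

namespace IsSubgradSplit

variable {E : Type*} [NormedAddCommGroup E] [InnerProductSpace ℝ E] [CompleteSpace E] {u : E → ℝ}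
    {K₁ K₂ : Set E} {x₀ a b : E} {δ α C : ℝ} {y y' p p' q q' : E}
    {F : Type*} [NormedAddCommGroup F] [InnerProductSpace ℝ F] [CompleteSpace F]
    {T : F →ₗᵢ[ℝ] E} {ν : E}

lemma norm_add_smul_le (hν : ‖ν‖ = 1) (t : F) (s : ℝ) : ‖T t + s • ν‖ ≤ ‖t‖ + |s| := by
  refine (norm_add_le _ _).trans ?_
  rw [T.norm_map, norm_smul, hν, mul_one, Real.norm_eq_abs]

lemma norm_le_norm_add_smul (hT : ∀ t, ⟪T t, ν⟫ = 0) (t : F) (s : ℝ) : ‖t‖ ≤ ‖T t + s • ν‖ := by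
  rcases (norm_nonneg t).eq_or_lt with h | h
  · rw [← h]; positivity
  · have h1 : ‖t‖ * ‖t‖ = ⟪T t, T t + s • ν⟫ := by
      rw [inner_add_right, real_inner_smul_right, hT, mul_zero, add_zero,
        real_inner_self_eq_norm_mul_norm, T.norm_map]
    have h2 := real_inner_le_norm (T t) (T t + s • ν)
    rw [← h1, T.norm_map] at h2
    exact le_of_mul_le_mul_left h2 h

lemma inner_add_smul (hab : a - b = ‖a - b‖ • ν) (hν : ‖ν‖ = 1) (hT : ∀ t, ⟪T t, ν⟫ = 0) (t : F)
    (s : ℝ) : ⟪a - b, T t + s • ν⟫ = ‖a - b‖ * s := by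
  rw [hab, norm_smul, hν, mul_one, norm_norm, real_inner_smul_left, inner_add_right,
    real_inner_comm, hT, real_inner_smul_right, real_inner_self_eq_norm_sq, hν]
  ring

/-- The singular points lie on a Lipschitz graph. -/
lemma abs_le_of_sub_eq (H : IsSubgradSplit u K₁ K₂ x₀ a b δ α C) (hab : a - b = ‖a - b‖ • ν)
    (hν : ‖ν‖ = 1) (hT : ∀ t, ⟪T t, ν⟫ = 0) (hy : y ∈ ball x₀ δ)
    (hy' : y' ∈ ball x₀ δ) (hp : p ∈ subgrad u y ∩ K₁) (hq : q ∈ subgrad u y ∩ K₂)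
    (hp' : p' ∈ subgrad u y' ∩ K₁) (hq' : q' ∈ subgrad u y' ∩ K₂) {t : F} {s : ℝ}
    (h : y' - y = T t + s • ν) : |s| ≤ ‖t‖ / 5 := by
  have h1 := H.abs_inner_sub_le hy hy' hp hq hp' hq'
  rw [h, inner_add_smul hab hν hT, abs_mul, abs_norm, div_mul_eq_mul_div, mul_div_assoc] at h1
  have h2 := le_of_mul_le_mul_left h1 H.norm_pos
  have h3 := norm_add_smul_le (T := T) hν t s
  linarith

lemma exists_mem_line (H : IsSubgradSplit u K₁ K₂ x₀ a b δ α C) (hab : a - b = ‖a - b‖ • ν)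
    (hν : ‖ν‖ = 1) (hT : ∀ t, ⟪T t, ν⟫ = 0) {t : F} (ht : ‖t‖ ≤ δ / 3) :
    ∃ s : ℝ, |s| ≤ δ / 3 ∧ (subgrad u (x₀ + (T t + s • ν)) ∩ K₁).Nonempty ∧
      (subgrad u (x₀ + (T t + s • ν)) ∩ K₂).Nonempty := by
  have hδ := H.radius_pos
  have hmem : ∀ s : ℝ, |s| ≤ δ / 3 → x₀ + (T t + s • ν) ∈ ball x₀ δ := by
    intro s hs
    rw [mem_ball_iff_norm, add_sub_cancel_left]
    have := norm_add_smul_le (T := T) hν t s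
    linarith
  have hcont : Continuous fun s : ℝ => x₀ + (T t + s • ν) := by fun_prop
  have hc := H.norm_pos
  have htop : subgrad u (x₀ + (T t + (δ / 3) • ν)) ∩ K₂ = ∅ := by
    refine H.not_mem_right (hmem _ (abs_of_pos (by positivity)).le) ?_
    rw [add_sub_cancel_left, inner_add_smul hab hν hT, div_mul_eq_mul_div, mul_div_assoc]
    refine mul_lt_mul_of_pos_left ?_ hc
    have := norm_add_smul_le (T := T) hν t (δ / 3)
    rw [abs_of_pos (by positivity)] at this
    linarith
  have hbot : subgrad u (x₀ + (T t + (-(δ / 3)) • ν)) ∩ K₁ = ∅ := by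
    refine H.symm.not_mem_right (hmem _ (by rw [abs_neg, abs_of_pos (by positivity)])) ?_
    rw [add_sub_cancel_left, ← neg_sub a b, inner_neg_left, norm_neg, inner_add_smul hab hν hT,
      div_mul_eq_mul_div, mul_div_assoc, ← mul_neg, neg_neg]
    refine mul_lt_mul_of_pos_left ?_ hc
    have := norm_add_smul_le (T := T) hν t (-(δ / 3))
    rw [abs_neg, abs_of_pos (by positivity)] at this
    linarith
  have hex : ∀ s : ℝ, (subgrad u (x₀ + (T t + s • ν)) ∩ K₁).Nonempty ∨
      (subgrad u (x₀ + (T t + s • ν)) ∩ K₂).Nonempty := by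
    intro s
    obtain ⟨p, hp, h | h⟩ := H.exists_subgrad (x₀ + (T t + s • ν))
    · exact Or.inl ⟨p, hp, h⟩
    · exact Or.inr ⟨p, hp, h⟩
  obtain ⟨s, hs, h1, h2⟩ := isPreconnected_closed_iff.1
    (isPreconnected_Icc (a := -(δ / 3)) (b := δ / 3)) _ _
    ((isClosed_nonempty H.continuous H.isCompact_left).preimage hcont)
    ((isClosed_nonempty H.continuous H.isCompact_right).preimage hcont) (fun s _ => hex s)
    ⟨δ / 3, right_mem_Icc.2 (by linarith), (hex _).resolve_right (by rw [htop]; simp)⟩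
    ⟨-(δ / 3), left_mem_Icc.2 (by linarith), (hex _).resolve_left (by rw [hbot]; simp)⟩
  exact ⟨s, abs_le.2 hs, h1, h2⟩

lemma inner_sub_mem (H : IsSubgradSplit u K₁ K₂ x₀ a b δ α C) (hab : a - b = ‖a - b‖ • ν)
    (hν : ‖ν‖ = 1) (hy : y ∈ ball x₀ δ) (hp : p ∈ subgrad u y ∩ K₁) (hq : q ∈ subgrad u y ∩ K₂) :
    5 / 6 * ‖a - b‖ ≤ ⟪p - q, ν⟫ ∧ ‖p - q‖ ≤ 7 / 6 * ‖a - b‖ := by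
  have h1 := H.near_left y hy p hp
  have h2 := H.near_right y hy q hq
  have h3 : ‖(p - q) - (a - b)‖ ≤ ‖a - b‖ / 6 := by
    rw [show (p - q) - (a - b) = (p - a) - (q - b) by abel]
    have := norm_sub_le (p - a) (q - b)
    linarith
  refine ⟨?_, ?_⟩
  · have h4 : ⟪p - q, ν⟫ = ‖a - b‖ + ⟪(p - q) - (a - b), ν⟫ := by
      have : ⟪a - b, ν⟫ = ‖a - b‖ := by
        rw [hab, real_inner_smul_left, real_inner_self_eq_norm_sq, norm_smul, hν, norm_norm]
        ring
      rw [inner_sub_left (p - q), this]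
      ring
    have h5 := (neg_le_abs _).trans (abs_real_inner_le_norm ((p - q) - (a - b)) ν)
    rw [hν, mul_one] at h5
    linarith
  · have := norm_le_norm_add_norm_sub (a - b) (p - q)
    rw [norm_sub_rev (a - b)] at this
    linarith

/-- Near `x₀`, the points with subgradients of both kinds form a `C^{1,α}` graph. -/
lemma exists_holder_graph [FiniteDimensional ℝ F] (H : IsSubgradSplit u K₁ K₂ x₀ a b δ α C)
    (hab : a - b = ‖a - b‖ • ν) (hν : ‖ν‖ = 1) (hT : ∀ t, ⟪T t, ν⟫ = 0)
    (hspan : ∀ y, ∃ (t : F) (s : ℝ), y = T t + s • ν) :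
    ∃ r > 0, r ≤ δ ∧ ∃ g : F → ℝ, Differentiable ℝ g ∧
      (∃ C' : ℝ, ∀ s t, ‖gradient g s - gradient g t‖ ≤ C' * ‖s - t‖ ^ α) ∧
      ∀ y ∈ ball x₀ r, ((subgrad u y ∩ K₁).Nonempty ∧ (subgrad u y ∩ K₂).Nonempty) ↔
        ∃ t, y = x₀ + (T t + g t • ν) := by
  have hδ := H.radius_pos
  have hc := H.norm_pos
  have hα := H.exponent_pos
  have hC := H.const_nonneg
  set c := ‖a - b‖ with hcdef
  set ρ := δ / 3 with hρdef
  have hρ : 0 < ρ := by positivity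
  have hex : ∀ t : F, ∃ (s : ℝ) (p q : E), t ∈ ball 0 ρ → |s| ≤ ρ ∧
      p ∈ subgrad u (x₀ + (T t + s • ν)) ∩ K₁ ∧ q ∈ subgrad u (x₀ + (T t + s • ν)) ∩ K₂ := by
    intro t
    by_cases ht : t ∈ ball 0 ρ
    · obtain ⟨s, hs, ⟨p, hp⟩, q, hq⟩ := H.exists_mem_line hab hν hT (mem_ball_zero_iff.1 ht).le
      exact ⟨s, p, q, fun _ => ⟨hs, hp, hq⟩⟩
    · exact ⟨0, 0, 0, fun h => absurd h ht⟩
  choose g P Q h using hex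
  set Y : F → E := fun t => x₀ + (T t + g t • ν) with hY
  have hYb : ∀ t ∈ ball (0 : F) ρ, Y t ∈ ball x₀ δ := by
    intro t ht
    rw [mem_ball_iff_norm, hY, add_sub_cancel_left]
    have h1 := norm_add_smul_le (T := T) hν t (g t)
    have h2 := (h t ht).1
    have h3 := mem_ball_zero_iff.1 ht
    linarith
  have hYs : ∀ s t, Y s - Y t = T (s - t) + (g s - g t) • ν := by
    intro s t
    simp only [hY, map_sub]
    module
  have hg1 : ∀ s ∈ ball (0 : F) ρ, ∀ t ∈ ball (0 : F) ρ, |g s - g t| ≤ ‖s - t‖ / 5 :=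
    fun s hs t ht => H.abs_le_of_sub_eq hab hν hT (hYb t ht) (hYb s hs) (h t ht).2.1 (h t ht).2.2
      (h s hs).2.1 (h s hs).2.2 (hYs s t)
  have hYn : ∀ s ∈ ball (0 : F) ρ, ∀ t ∈ ball (0 : F) ρ, ‖Y s - Y t‖ ≤ 2 * ‖s - t‖ := by
    intro s hs t ht
    rw [hYs]
    have h1 := norm_add_smul_le (T := T) hν (s - t) (g s - g t)
    have h2 := hg1 s hs t ht
    have := norm_nonneg (s - t)
    linarith
  have hYne : ∀ s t, s ≠ t → Y s ≠ Y t := by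
    intro s t hst heq
    have h1 := norm_le_norm_add_smul hT (s - t) (g s - g t)
    rw [← hYs, heq, sub_self, norm_zero] at h1
    exact hst (sub_eq_zero.1 (norm_le_zero_iff.1 h1))
  set N : F → E := fun t => P t - Q t with hN
  set A := ContinuousLinearMap.adjoint T.toContinuousLinearMap with hA
  have hAin : ∀ n t, ⟪A n, t⟫ = ⟪n, T t⟫ := fun n t => by
    rw [hA, ContinuousLinearMap.adjoint_inner_left]; rfl
  have hAn : ∀ n, ‖A n‖ ≤ ‖n‖ := by
    intro n
    have h1 : ‖A n‖ * ‖A n‖ ≤ ‖n‖ * ‖A n‖ := by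
      rw [← real_inner_self_eq_norm_mul_norm, hAin, ← T.norm_map (A n)]
      exact real_inner_le_norm _ _
    rcases (norm_nonneg (A n)).eq_or_lt with h0 | h0
    · rw [← h0]; positivity
    · exact le_of_mul_le_mul_right h1 h0
  have hNm : ∀ t ∈ ball (0 : F) ρ, 5 / 6 * c ≤ ⟪N t, ν⟫ ∧ ‖N t‖ ≤ 7 / 6 * c := fun t ht =>
    H.inner_sub_mem hab hν (hYb t ht) (h t ht).2.1 (h t ht).2.2
  have hNh : ∀ s ∈ ball (0 : F) ρ, ∀ t ∈ ball (0 : F) ρ, s ≠ t →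
      ‖N s - N t‖ ≤ 2 * C * 2 ^ α * ‖s - t‖ ^ α := by
    intro s hs t ht hst
    have h1 := H.holder_left _ (hYb s hs) _ (hYb t ht) (hYne s t hst) _ (h s hs).2.1 _ (h t ht).2.1
    have h2 := H.holder_right _ (hYb s hs) _ (hYb t ht) (hYne s t hst) _ (h s hs).2.2 _
      (h t ht).2.2
    have h3 : ‖Y s - Y t‖ ^ α ≤ 2 ^ α * ‖s - t‖ ^ α := by
      rw [← Real.mul_rpow two_pos.le (norm_nonneg _)]
      exact Real.rpow_le_rpow (norm_nonneg _) (hYn s hs t ht) hα.le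
    have h4 := mul_le_mul_of_nonneg_left h3 hC
    have h5 : N s - N t = (P s - P t) - (Q s - Q t) := by simp only [hN]; abel
    rw [h5]
    have h6 := norm_sub_le (P s - P t) (Q s - Q t)
    linarith
  set v : F → F := fun t => -(⟪N t, ν⟫⁻¹ • A (N t)) with hv
  have hvh : ∀ s ∈ ball (0 : F) ρ, ∀ t ∈ ball (0 : F) ρ,
      ‖v s - v t‖ ≤ (3 / c * (2 * C * 2 ^ α)) * ‖s - t‖ ^ α := by
    intro s hs t ht
    rcases eq_or_ne s t with rfl | hst
    · rw [sub_self, norm_zero]; positivity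
    have h1 : v s - v t = -(⟪N s, ν⟫⁻¹ • A (N s) - ⟪N t, ν⟫⁻¹ • A (N t)) := by
      simp only [hv]; abel
    rw [h1, norm_neg, mul_assoc]
    refine norm_inv_smul_sub_inv_smul_le hc (hNm s hs).1 (hNm t ht).1
      ((hAn _).trans (hNm t ht).2) ?_ ?_
    · rw [← inner_sub_left]
      refine (abs_real_inner_le_norm _ _).trans ?_
      rw [hν, mul_one]
      exact hNh s hs t ht hst
    · rw [← map_sub]
      exact (hAn _).trans (hNh s hs t ht hst)
  have hgv : ∀ t ∈ ball (0 : F) ρ, HasGradientAt g (v t) t := by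
    intro t ht
    rw [hasGradientAt_iff_isLittleO]
    have hm := (hNm t ht).1
    have hm0 : 0 < ⟪N t, ν⟫ := lt_of_lt_of_le (by positivity) hm
    have hbd : ∀ s ∈ ball (0 : F) ρ, ‖g s - g t - ⟪v t, s - t⟫‖ ≤
        ⟪N t, ν⟫⁻¹ * (C * (2 * ‖s - t‖) ^ α * (2 * ‖s - t‖)) := by
      intro s hs
      rcases eq_or_ne s t with rfl | hst
      · simp
      have h1 := H.abs_inner_pair_le (hYb t ht) (hYb s hs) (hYne t s hst.symm) (h t ht).2.1
        (h t ht).2.2 (h s hs).2.1 (h s hs).2.2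
      have h2 : g s - g t - ⟪v t, s - t⟫ = ⟪N t, ν⟫⁻¹ * ⟪P t - Q t, Y s - Y t⟫ := by
        rw [hYs, inner_add_right, real_inner_smul_right]
        simp only [hv, inner_neg_left, real_inner_smul_left, hAin]
        change _ = ⟪N t, ν⟫⁻¹ * (⟪N t, T (s - t)⟫ + (g s - g t) * ⟪N t, ν⟫)
        field_simp
        ring
      rw [h2, norm_mul, Real.norm_eq_abs, Real.norm_eq_abs, abs_of_pos (inv_pos.2 hm0)]
      have h3 := hYn s hs t ht
      gcongr
      refine h1.trans ?_
      gcongr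
    have hlim : Filter.Tendsto (fun s => ⟪N t, ν⟫⁻¹ * (C * (2 * ‖s - t‖) ^ α * 2)) (nhds t)
        (nhds 0) := by
      have hcont : Continuous fun s : F => ⟪N t, ν⟫⁻¹ * (C * (2 * ‖s - t‖) ^ α * 2) := by
        have : Continuous fun s : F => (2 * ‖s - t‖) ^ α :=
          (by fun_prop : Continuous fun s : F => 2 * ‖s - t‖).rpow_const fun _ => Or.inr hα.le
        fun_prop
      refine hcont.tendsto' _ _ ?_
      simp [hα.ne']
    rw [Asymptotics.isLittleO_iff]
    intro κ hκ
    filter_upwards [hlim.eventually_lt_const hκ, isOpen_ball.mem_nhds ht] with s hs1 hs2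
    refine (hbd s hs2).trans ?_
    calc _ = ⟪N t, ν⟫⁻¹ * (C * (2 * ‖s - t‖) ^ α * 2) * ‖s - t‖ := by ring
      _ ≤ _ := mul_le_mul_of_nonneg_right hs1.le (norm_nonneg _)
  obtain ⟨G, hGd, hGh, hGg⟩ := exists_holder_gradient_extension hρ hα H.exponent_lt (by positivity)
    (fun t ht => (h t ht).1)
    (fun s hs t ht => (hg1 s hs t ht).trans (by have := norm_nonneg (s - t); linarith)) hgv hvh
  refine ⟨ρ / 2, by positivity, by linarith, G, hGd, hGh, fun y hy => ⟨?_, ?_⟩⟩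
  · rintro ⟨⟨p, hp⟩, q, hq⟩
    obtain ⟨t, s, hts⟩ := hspan (y - x₀)
    have ht : t ∈ ball (0 : F) (ρ / 2) := by
      rw [mem_ball_zero_iff]
      refine (norm_le_norm_add_smul hT t s).trans_lt ?_
      rw [← hts]
      exact mem_ball_iff_norm.1 hy
    have ht' := ball_subset_ball (by linarith : ρ / 2 ≤ ρ) ht
    have hyδ : y ∈ ball x₀ δ := ball_subset_ball (by linarith) hy
    have hy' : y = x₀ + (T t + s • ν) := by rw [← hts]; abel
    have h1 : y - Y t = T (0 : F) + (s - g t) • ν := by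
      rw [hy', map_zero]
      simp only [hY]
      module
    have h2 := H.abs_le_of_sub_eq hab hν hT (hYb t ht') hyδ (h t ht').2.1 (h t ht').2.2 hp hq h1
    rw [norm_zero, zero_div, abs_nonpos_iff, sub_eq_zero] at h2
    exact ⟨t, by rw [hy', h2, hGg t ht]⟩
  · rintro ⟨t, rfl⟩
    have ht : t ∈ ball (0 : F) (ρ / 2) := by
      rw [mem_ball_zero_iff]
      refine (norm_le_norm_add_smul hT t (G t)).trans_lt ?_
      rw [mem_ball_iff_norm, add_sub_cancel_left] at hy
      exact hy
    have ht' := ball_subset_ball (by linarith : ρ / 2 ≤ ρ) ht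
    rw [hGg t ht]
    exact ⟨⟨_, (h t ht').2.1⟩, _, (h t ht').2.2⟩

end IsSubgradSplit

/-- when the target is a union of two bounded convex domains in `ℝⁿ`, the
singular set of the Brenier potential is locally an `(n-1)`-dimensional `C^{1,α}` graph. -/
theorem singular_set_C1alpha_union_two_convex
    (n : ℕ) (hn : 2 ≤ n)
    (Ω Ωs Ωs₁ Ωs₂ : Set (EuclideanSpace ℝ (Fin n)))
    (hΩo : IsOpen Ω) (hΩb : Bornology.IsBounded Ω)
    (hΩs₁o : IsOpen Ωs₁) (hΩs₁b : Bornology.IsBounded Ωs₁) (hΩs₁c : Convex ℝ Ωs₁)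
    (hΩs₂o : IsOpen Ωs₂) (hΩs₂b : Bornology.IsBounded Ωs₂) (hΩs₂c : Convex ℝ Ωs₂)
    (hΩs : Ωs = Ωs₁ ∪ Ωs₂)
    (hvol : volume Ω = volume Ωs)
    (u : EuclideanSpace ℝ (Fin n) → ℝ) (hconv : ConvexOn ℝ Set.univ u)
    (K : ℝ≥0) (hLip : LipschitzWith K u)
    (hae : ∀ᵐ x : EuclideanSpace ℝ (Fin n),
      DifferentiableAt ℝ u x ∧ gradient u x ∈ closure Ωs)
    (hpush : ∀ E : Set (EuclideanSpace ℝ (Fin n)), MeasurableSet E →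
      volume {x ∈ Ω | DifferentiableAt ℝ u x ∧ gradient u x ∈ E} = volume (E ∩ Ωs))
    (A : Set (EuclideanSpace ℝ (Fin n)))
    (hA : A = {x ∈ Ω | ¬ DifferentiableAt ℝ u x}) :
    ∀ x ∈ A, ∃ (rx : ℝ) (α : ℝ), 0 < rx ∧ α ∈ Set.Ioo (0 : ℝ) 1 ∧
      ∃ (e : Fin (n - 1) → EuclideanSpace ℝ (Fin n)) (eₙ : EuclideanSpace ℝ (Fin n))
        (g : EuclideanSpace ℝ (Fin (n - 1)) → ℝ),
        Orthonormal ℝ e ∧ ‖eₙ‖ = 1 ∧ (∀ i : Fin (n - 1), ⟪e i, eₙ⟫ = 0) ∧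
        Differentiable ℝ g ∧
        (∃ Cg : ℝ, ∀ s t : EuclideanSpace ℝ (Fin (n - 1)),
          ‖gradient g s - gradient g t‖ ≤ Cg * ‖s - t‖ ^ α) ∧
        A ∩ ball x rx =
          {y : EuclideanSpace ℝ (Fin n) | ∃ t : EuclideanSpace ℝ (Fin (n - 1)),
            y = x + (∑ i : Fin (n - 1), t i • e i) + g t • eₙ} ∩ ball x rx := by
  subst hΩs hA
  rintro x ⟨hxΩ, hxd⟩
  have H : IsTransportPotential volume Ω Ωs₁ Ωs₂ u :=
    { isOpen_source := hΩo
      bounded_source := hΩb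
      isOpen_left := hΩs₁o
      bounded_left := hΩs₁b
      convex_left := hΩs₁c
      isOpen_right := hΩs₂o
      bounded_right := hΩs₂b
      convex_right := hΩs₂c
      convexOn := hconv
      continuous := hLip.continuous
      ae_mem := hae
      push := hpush }
  obtain ⟨a, b, δ, α, C, hδΩ, hS⟩ := H.exists_isSubgradSplit hxΩ hxd
  have hc := hS.norm_pos
  set ν := ‖a - b‖⁻¹ • (a - b) with hνdef
  have hν : ‖ν‖ = 1 := by
    rw [hνdef, norm_smul, norm_inv, norm_norm, inv_mul_cancel₀ hc.ne']
  have hab : a - b = ‖a - b‖ • ν := by rw [hνdef, smul_smul, mul_inv_cancel₀ hc.ne', one_smul]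
  have : Fact (Module.finrank ℝ (EuclideanSpace ℝ (Fin n)) = n - 1 + 1) :=
    ⟨by rw [finrank_euclideanSpace_fin]; omega⟩
  let B : OrthonormalBasis (Fin (n - 1)) ℝ (ℝ ∙ ν)ᗮ :=
    OrthonormalBasis.fromOrthogonalSpanSingleton (n - 1) (norm_ne_zero_iff.1 (by simp [hν]))
  let T : EuclideanSpace ℝ (Fin (n - 1)) →ₗᵢ[ℝ] EuclideanSpace ℝ (Fin n) :=
    (ℝ ∙ ν)ᗮ.subtypeₗᵢ.comp B.repr.symm.toLinearIsometry
  have hTsum : ∀ t, T t = ∑ i, t i • (B i : EuclideanSpace ℝ (Fin n)) := by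
    intro t
    have h1 : T t = ((B.repr.symm t : (ℝ ∙ ν)ᗮ) : EuclideanSpace ℝ (Fin n)) := rfl
    rw [h1, ← B.sum_repr_symm t]
    simp
  have hTν : ∀ t, ⟪T t, ν⟫ = 0 := fun t =>
    Submodule.mem_orthogonal_singleton_iff_inner_left.1 (B.repr.symm t).2
  have hspan : ∀ y, ∃ (t : EuclideanSpace ℝ (Fin (n - 1))) (s : ℝ), y = T t + s • ν := by
    intro y
    have hmem : y - ⟪ν, y⟫ • ν ∈ (ℝ ∙ ν)ᗮ := by
      rw [Submodule.mem_orthogonal_singleton_iff_inner_right, inner_sub_right,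
        real_inner_smul_right, real_inner_self_eq_norm_sq, hν]
      ring
    refine ⟨B.repr ⟨_, hmem⟩, ⟪ν, y⟫, ?_⟩
    have h1 : T (B.repr ⟨_, hmem⟩) = y - ⟪ν, y⟫ • ν := by
      change ((B.repr.symm (B.repr ⟨_, hmem⟩) : (ℝ ∙ ν)ᗮ) : EuclideanSpace ℝ (Fin n)) = _
      rw [LinearIsometryEquiv.symm_apply_apply]
    rw [h1, sub_add_cancel]
  obtain ⟨r, hr, hrδ, g, hg, hgh, hgraph⟩ := hS.exists_holder_graph hab hν hTν hspan
  refine ⟨r, α, hr, ⟨hS.exponent_pos, hS.exponent_lt⟩, fun i => B i, ν, g,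
    B.orthonormal.comp_linearIsometry (ℝ ∙ ν)ᗮ.subtypeₗᵢ, hν,
    fun i => Submodule.mem_orthogonal_singleton_iff_inner_left.1 (B i).2, hg, hgh, ?_⟩
  ext y
  refine and_congr_left fun hy => ?_
  have hyδ := ball_subset_ball hrδ hy
  simp only [mem_ofPred_eq, add_assoc, ← hTsum]
  rw [← hgraph y hy]
  constructor
  · rintro ⟨hyΩ, hyd⟩
    obtain ⟨p, q, -, hp, hq⟩ := H.exists_pair hyΩ hyd
    rw [hp, hq]
    exact ⟨singleton_nonempty p, singleton_nonempty q⟩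
  · rintro ⟨⟨p, hp⟩, q, hq⟩
    exact ⟨hδΩ hyδ, hS.not_differentiableAt hyδ hp hq⟩
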